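/- arXiv:1509.01716 — 5 statements merged into one kernel-verified Lean document; each statement's English description precedes it below -/
import Mathlib

section
/- Let a < b be real numbers and n ≥ 1 a natural number. Let μ₁, μ₂ be finite signed measures on ℝ concentrated on (a,b], with distribution functions F₁(x) = μ₁((a,x]) and F₂(x) = μ₂((a,x]). Then ∫_{[a,b]} f dμ₁ ≤ ∫_{[a,b]} f dμ₂ holds for every continuous n-convex function f : [a,b] → ℝ if and only if the following conditions hold: (i) F₁(b) = F₂(b); (ii) ∫_a^b F₁(x) dx = ∫_a^b F₂(x) dx; (iii) for every k = 2, …, n, ∫_a^b ∫_a^{x_{k−1}} ⋯ ∫_a^{x₁} F₁(t) dt dx₁ ⋯ dx_{k−1} = ∫_a^b ∫_a^{x_{k−1}} ⋯ ∫_a^{x₁} F₂(t) dt dx₁ ⋯ dx_{k−1} (a (k)-fold iterated integral with outermost upper limit b); (iv) for every x ∈ (a,b), (−1)^{n+1} ∫_a^x ∫_a^{x_{n−1}} ⋯ ∫_a^{x₁} F₁(t) dt dx₁ ⋯ dx_{n−1} ≤ (−1)^{n+1} ∫_a^x ∫_a^{x_{n−1}} ⋯ ∫_a^{x₁} F₂(t)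 dt dx₁ ⋯ dx_{n−1} (an (n)-fold iterated integral with outermost upper limit x). -/
open MeasureTheory Set

/-- Integral of `f` with respect to a finite signed measure `μ`,
defined via the Jordan decomposition `μ = μ⁺ - μ⁻`. -/
noncomputable def sintegral (μ : SignedMeasure ℝ) (f : ℝ → ℝ) : ℝ :=
  (∫ x, f x ∂μ.toJordanDecomposition.posPart) - ∫ x, f x ∂μ.toJordanDecomposition.negPart

/-- Integral of `f` over a set `s` with respect to a finite signed measure `μ`. -/
noncomputable def sintegralOn (μ : SignedMeasure ℝ) (s : Set ℝ) (f : ℝ → ℝ) : ℝ :=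
  (∫ x in s, f x ∂μ.toJordanDecomposition.posPart) - ∫ x in s, f x ∂μ.toJordanDecomposition.negPart

/-- A signed measure `μ` is concentrated on `s` if `|μ|(sᶜ) = 0`. -/
def ConcentratedOn (μ : SignedMeasure ℝ) (s : Set ℝ) : Prop :=
  μ.totalVariation sᶜ = 0

/-- Iterated integrals based at `a`: `I₀ = F`, `I_{k+1}(x) = ∫_a^x I_k(t) dt`. -/
noncomputable def iterInt (a : ℝ) (F : ℝ → ℝ) : ℕ → ℝ → ℝ
  | 0 => F
  | k + 1 => fun x => ∫ t in a..x, iterInt a F k t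

/-- `f` is `n`-convex on `(a,b)` (`n ≥ 1`): it is `(n-1)`-times differentiable on `(a,b)`
and its `(n-1)`-st derivative is convex on `(a,b)`. -/
def NConvexOn (n : ℕ) (a b : ℝ) (f : ℝ → ℝ) : Prop :=
  ContDiffOn ℝ ((n - 1 : ℕ) : ℕ∞) f (Ioo a b) ∧
  ConvexOn ℝ (Ioo a b) (iteratedDerivWithin (n - 1) f (Ioo a b))

lemma hasDerivAt_fwdDiff_iter {a b h : ℝ} (hh : 0 < h) {g g' : ℝ → ℝ}
    (hg : ∀ x ∈ Ioo a b, HasDerivAt g (g' x) x) (r : ℕ) :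
    ∀ x, a < x → x + r * h < b → HasDerivAt ((fwdDiff h)^[r] g) ((fwdDiff h)^[r] g' x) x := by
  induction r with
  | zero => intro x hx hxb; exact hg x ⟨hx, by simpa using hxb⟩
  | succ r ih =>
    intro x hx hxb
    push_cast at hxb
    simp only [Function.iterate_succ_apply', fwdDiff]
    exact (HasDerivAt.comp_add_const x h (ih (x + h) (by linarith) (by linarith))).sub
      (ih x hx (by linarith))

lemma fwdDiff_iter_succ_nonneg_of_hasDerivAt {a b h : ℝ} (hh : 0 < h) {g g' : ℝ → ℝ} {r : ℕ}
    (hg : ∀ x ∈ Ioo a b, HasDerivAt g (g' x) x)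
    (hg' : ∀ x, a < x → x + r * h < b → 0 ≤ (fwdDiff h)^[r] g' x)
    (x : ℝ) (hx : a < x) (hxb : x + (r + 1 : ℕ) * h < b) : 0 ≤ (fwdDiff h)^[r + 1] g x := by
  push_cast at hxb
  have hd : ∀ y ∈ Icc x (x + h), HasDerivAt ((fwdDiff h)^[r] g) ((fwdDiff h)^[r] g' y) y := fun y hy =>
    hasDerivAt_fwdDiff_iter hh hg r y (hx.trans_le hy.1) (by linarith [hy.2])
  have hmono : MonotoneOn ((fwdDiff h)^[r] g) (Icc x (x + h)) := by
    refine monotoneOn_of_hasDerivWithinAt_nonneg (convex_Icc _ _)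
      (fun y hy => (hd y hy).continuousAt.continuousWithinAt)
      (fun y hy => (hd y (interior_subset hy)).hasDerivWithinAt) fun y hy => ?_
    have hy' := interior_subset hy
    exact hg' y (hx.trans_le hy'.1) (by linarith [hy'.2])
  rw [Function.iterate_succ_apply', fwdDiff, sub_nonneg]
  exact hmono ⟨le_rfl, by linarith⟩ ⟨by linarith, le_rfl⟩ (by linarith)

lemma fwdDiff_two_nonneg_of_convexOn {a b h : ℝ} (hh : 0 < h) {g : ℝ → ℝ}
    (hg : ConvexOn ℝ (Ioo a b) g) (x : ℝ) (hx : a < x) (hxb : x + (2 : ℕ) * h < b) :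
    0 ≤ (fwdDiff h)^[2] g x := by
  push_cast at hxb
  have := hg.2 (show x ∈ Ioo a b from ⟨hx, by linarith⟩)
    (show x + h + h ∈ Ioo a b from ⟨by linarith, by linarith⟩)
    (show (0 : ℝ) ≤ 1 / 2 by norm_num) (show (0 : ℝ) ≤ 1 / 2 by norm_num) (by norm_num)
  simp only [smul_eq_mul] at this
  rw [show 1 / 2 * x + 1 / 2 * (x + h + h) = x + h by ring] at this
  simp only [Function.iterate_succ_apply', Function.iterate_zero_apply, fwdDiff]
  linarith

lemma NConvexOn.fwdDiff_iter_nonneg {n : ℕ} (hn : 1 ≤ n) {a b h : ℝ} (hh : 0 < h) {f : ℝ → ℝ}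
    (hf : NConvexOn n a b f) (x : ℝ) (hx : a < x) (hxb : x + (n + 1 : ℕ) * h < b) :
    0 ≤ (fwdDiff h)^[n + 1] f x := by
  obtain ⟨m, rfl⟩ : ∃ m, n = m + 1 := ⟨n - 1, by omega⟩
  obtain ⟨hd, hc⟩ := hf
  simp only [Nat.add_sub_cancel] at hd hc
  replace hd : ContDiffOn ℝ (m : WithTop ℕ∞) f (Ioo a b) := hd
  have key : ∀ j ≤ m, ∀ x, a < x → x + (j + 2 : ℕ) * h < b →
      0 ≤ (fwdDiff h)^[j + 2] (iteratedDerivWithin (m - j) f (Ioo a b)) x := by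
    intro j
    induction j with
    | zero => intro _; exact fwdDiff_two_nonneg_of_convexOn hh hc
    | succ j ih =>
      intro hj
      refine fwdDiff_iter_succ_nonneg_of_hasDerivAt hh (fun y hy => ?_) (ih (by omega))
      have h1 : DifferentiableOn ℝ (iteratedDerivWithin (m - (j + 1)) f (Ioo a b)) (Ioo a b) :=
        hd.differentiableOn_iteratedDerivWithin (by
          exact_mod_cast (show m - (j + 1) < m by omega)) isOpen_Ioo.uniqueDiffOn
      have h2 := h1.hasDerivAt (isOpen_Ioo.mem_nhds hy)
      rwa [← derivWithin_of_isOpen isOpen_Ioo hy, ← iteratedDerivWithin_succ,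
        show m - (j + 1) + 1 = m - j by omega] at h2
  have := key m le_rfl x hx hxb
  simpa using this

lemma NConvexOn.fwdDiff_iter_nonneg_of_continuousOn {n : ℕ} (hn : 1 ≤ n) {a b h : ℝ} (hab : a < b)
    (hh : 0 < h) {f : ℝ → ℝ} (hf : NConvexOn n a b f) (hc : ContinuousOn f (Icc a b))
    (x : ℝ) (hx : a ≤ x) (hxb : x + (n + 1 : ℕ) * h ≤ b) :
    0 ≤ (fwdDiff h)^[n + 1] f x := by
  set c := (a + b) / 2 with hcdef
  have hlim : Filter.Tendsto (fun l : ℝ => (fwdDiff (l * h))^[n + 1] f (c + l * (x - c)))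
      (nhdsWithin 1 (Ioo 0 1)) (nhds ((fwdDiff h)^[n + 1] f x)) := by
    simp only [fwdDiff_iter_eq_sum_shift]
    refine tendsto_finsetSum _ fun i hi => Filter.Tendsto.const_smul ?_ _
    have hi' : (i : ℝ) ≤ (n + 1 : ℕ) := by
      exact_mod_cast Nat.lt_succ_iff.mp (Finset.mem_range.mp hi)
    have hi0 : (0 : ℝ) ≤ i := Nat.cast_nonneg _
    have hm : x + i • h ∈ Icc a b := by
      rw [nsmul_eq_mul]
      constructor <;> nlinarith
    refine (hc _ hm).tendsto.comp (tendsto_nhdsWithin_iff.mpr ⟨?_, ?_⟩)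
    · have : Continuous fun l : ℝ => c + l * (x - c) + i • (l * h) := by fun_prop
      convert! (this.tendsto 1).mono_left nhdsWithin_le_nhds using 2
      ring
    · filter_upwards [self_mem_nhdsWithin] with l hl
      rw [nsmul_eq_mul] at hm ⊢
      have : c + l * (x - c) + i * (l * h) = c + l * (x + i * h - c) := by ring
      rw [this]
      constructor <;> nlinarith [hl.1, hl.2, hm.1, hm.2]
  have : (nhdsWithin (1 : ℝ) (Ioo 0 1)).NeBot := by
    rw [← mem_closure_iff_nhdsWithin_neBot, closure_Ioo (by norm_num)]
    simp
  refine ge_of_tendsto hlim ?_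
  filter_upwards [self_mem_nhdsWithin] with l hl
  refine hf.fwdDiff_iter_nonneg hn (mul_pos hl.1 hh) _ ?_ ?_
  · nlinarith [hl.1, hl.2]
  · have : c + l * (x - c) + (n + 1 : ℕ) * (l * h) = c + l * (x + (n + 1 : ℕ) * h - c) := by ring
    rw [this]
    nlinarith [hl.1, hl.2]

open Polynomial in
/-- The `N`-th Bernstein polynomial with coefficients `c 0, …, c N`. -/
noncomputable def bernsteinSum (N : ℕ) (c : ℕ → ℝ) : ℝ[X] :=
  ∑ k ∈ Finset.range (N + 1), C (c k) * bernsteinPolynomial ℝ N k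

open Polynomial in
lemma derivative_bernsteinSum (N : ℕ) (c : ℕ → ℝ) :
    derivative (bernsteinSum (N + 1) c) = C (N + 1 : ℝ) * bernsteinSum N (fwdDiff 1 c) := by
  have h0 : bernsteinPolynomial ℝ N (N + 1) = 0 := bernsteinPolynomial.eq_zero_of_lt ℝ (by omega)
  simp only [bernsteinSum, derivative_sum, derivative_C_mul, fwdDiff]
  rw [Finset.sum_range_succ']
  simp only [bernsteinPolynomial.derivative_succ, bernsteinPolynomial.derivative_zero,
    Nat.add_sub_cancel, C_sub, sub_mul, Finset.sum_sub_distrib, mul_sub]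
  have h1 : ∑ k ∈ Finset.range (N + 1), C (c (k + 1)) * bernsteinPolynomial ℝ N (k + 1)
      + C (c 0) * bernsteinPolynomial ℝ N 0
      = ∑ k ∈ Finset.range (N + 1), C (c k) * bernsteinPolynomial ℝ N k := by
    rw [← Finset.sum_range_succ' (fun k => C (c k) * bernsteinPolynomial ℝ N k),
      Finset.sum_range_succ, h0, mul_zero, add_zero]
  rw [← h1, mul_add, Finset.mul_sum, Finset.mul_sum]
  simp only [mul_left_comm (C (c _)) (((N + 1 : ℕ) : ℝ[X]))]
  push_cast
  simp only [C_add, C_1, map_natCast]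
  ring

open Polynomial in
lemma iterate_derivative_bernsteinSum_nonneg (r : ℕ) :
    ∀ (N : ℕ) (c : ℕ → ℝ), (∀ k, k + r ≤ N → 0 ≤ (fwdDiff 1)^[r] c k) →
      ∀ x ∈ Icc (0 : ℝ) 1, 0 ≤ (derivative^[r] (bernsteinSum N c)).eval x := by
  induction r with
  | zero =>
    intro N c hc x hx
    simp only [bernsteinSum, bernsteinPolynomial, Function.iterate_zero_apply, eval_finsetSum]
    refine Finset.sum_nonneg fun k hk => ?_
    have h1 := hc k (by simpa [Nat.lt_succ_iff] using hk)
    have h2 := hx.1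
    have h3 : 0 ≤ 1 - x := by linarith [hx.2]
    simp only [Function.iterate_zero_apply] at h1
    simp only [eval_mul, eval_C, eval_natCast, eval_pow, eval_X, eval_sub, eval_one]
    positivity
  | succ r ih =>
    intro N c hc x hx
    rcases N with _ | N
    · simp [bernsteinSum, bernsteinPolynomial, Function.iterate_succ_apply]
    · rw [Function.iterate_succ_apply, derivative_bernsteinSum, iterate_derivative_C_mul, eval_mul,
        eval_C]
      refine mul_nonneg (by positivity) (ih N _ (fun k hk => ?_) x hx)
      exact hc k (by omega)

lemma fwdDiff_iter_comp_affine (f : ℝ → ℝ) (x h : ℝ) (r k : ℕ) :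
    (fwdDiff 1)^[r] (fun j : ℕ => f (x + j * h)) k = (fwdDiff h)^[r] f (x + k * h) := by
  simp only [fwdDiff_iter_eq_sum_shift]
  refine Finset.sum_congr rfl fun i _ => ?_
  congr 2
  push_cast [nsmul_eq_mul]
  ring

section SignedIntegral

variable {μ : SignedMeasure ℝ} {s : Set ℝ} {f g : ℝ → ℝ}

lemma posPart_le_totalVariation (μ : SignedMeasure ℝ) :
    μ.toJordanDecomposition.posPart ≤ μ.totalVariation :=
  Measure.le_add_right le_rfl

lemma negPart_le_totalVariation (μ : SignedMeasure ℝ) :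
    μ.toJordanDecomposition.negPart ≤ μ.totalVariation :=
  Measure.le_add_left le_rfl

lemma sintegralOn_congr (hs : MeasurableSet s) (h : EqOn f g s) :
    sintegralOn μ s f = sintegralOn μ s g := by
  rw [sintegralOn, sintegralOn, setIntegral_congr_fun hs h, setIntegral_congr_fun hs h]

lemma sintegralOn_add (hf : IntegrableOn f s μ.totalVariation)
    (hg : IntegrableOn g s μ.totalVariation) :
    sintegralOn μ s (fun t => f t + g t) = sintegralOn μ s f + sintegralOn μ s g := by
  have hp := posPart_le_totalVariation μ
  have hn := negPart_le_totalVariation μ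
  rw [sintegralOn, integral_add (hf.mono_measure hp) (hg.mono_measure hp),
    integral_add (hf.mono_measure hn) (hg.mono_measure hn), sintegralOn, sintegralOn]
  ring

lemma sintegralOn_const_mul (c : ℝ) :
    sintegralOn μ s (fun t => c * f t) = c * sintegralOn μ s f := by
  rw [sintegralOn, integral_const_mul, integral_const_mul, sintegralOn, mul_sub]

lemma sintegralOn_sum {ι : Type*} (S : Finset ι) {F : ι → ℝ → ℝ}
    (hF : ∀ i ∈ S, IntegrableOn (F i) s μ.totalVariation) :
    sintegralOn μ s (fun t => ∑ i ∈ S, F i t) = ∑ i ∈ S, sintegralOn μ s (F i) := by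
  have hp := posPart_le_totalVariation μ
  have hn := negPart_le_totalVariation μ
  rw [sintegralOn, integral_finsetSum _ fun i hi => (hF i hi).mono_measure hp,
    integral_finsetSum _ fun i hi => (hF i hi).mono_measure hn, ← Finset.sum_sub_distrib]
  rfl

lemma tendsto_sintegralOn_of_bounded {F : ℕ → ℝ → ℝ} {C : ℝ} (hs : MeasurableSet s)
    (hF : ∀ N, ContinuousOn (F N) s) (hC : ∀ᶠ N in Filter.atTop, ∀ t ∈ s, |F N t| ≤ C)
    (hlim : ∀ t ∈ s, Filter.Tendsto (fun N => F N t) Filter.atTop (nhds (f t))) :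
    Filter.Tendsto (fun N => sintegralOn μ s (F N)) Filter.atTop (nhds (sintegralOn μ s f)) := by
  have key : ∀ (ν : Measure ℝ) [IsFiniteMeasure ν],
      Filter.Tendsto (fun N => ∫ t in s, F N t ∂ν) Filter.atTop (nhds (∫ t in s, f t ∂ν)) := by
    intro ν _
    refine tendsto_integral_filter_of_dominated_convergence (fun _ => C)
      (Filter.Eventually.of_forall fun N => (hF N).aestronglyMeasurable hs) ?_
      (integrable_const _) ?_
    · filter_upwards [hC] with N hN
      filter_upwards [ae_restrict_mem hs] with t ht using hN t ht
    · filter_upwards [ae_restrict_mem hs] with t ht using hlim t ht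
  exact (key _).sub (key _)

lemma integrable_uncurry_prod_restrict {a x C : ℝ} {K : ℝ → ℝ → ℝ} (hax : a ≤ x)
    (hs : MeasurableSet s) (hK : Measurable (Function.uncurry K))
    (hC : ∀ u ∈ Ioc a x, ∀ t ∈ s, |K u t| ≤ C) (ν : Measure ℝ) [IsFiniteMeasure ν] :
    Integrable (Function.uncurry K) ((volume.restrict (uIoc a x)).prod (ν.restrict s)) := by
  rw [uIoc_of_le hax]
  refine Integrable.of_bound hK.aestronglyMeasurable C ?_
  rw [Measure.prod_restrict]
  filter_upwards [ae_restrict_mem (measurableSet_Ioc.prod hs)] with p hp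
  exact hC _ hp.1 _ hp.2

lemma intervalIntegrable_sintegralOn {a x C : ℝ} {K : ℝ → ℝ → ℝ} (hax : a ≤ x)
    (hs : MeasurableSet s) (hK : Measurable (Function.uncurry K))
    (hC : ∀ u ∈ Ioc a x, ∀ t ∈ s, |K u t| ≤ C) :
    IntervalIntegrable (fun u => sintegralOn μ s (K u)) volume a x := by
  simp only [sintegralOn, intervalIntegrable_iff]
  exact (integrable_uncurry_prod_restrict hax hs hK hC _).integral_prod_left.sub
    (integrable_uncurry_prod_restrict hax hs hK hC _).integral_prod_left

lemma intervalIntegral_sintegralOn_swap {a x C : ℝ} {K : ℝ → ℝ → ℝ} (hax : a ≤ x)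
    (hs : MeasurableSet s) (hK : Measurable (Function.uncurry K))
    (hC : ∀ u ∈ Ioc a x, ∀ t ∈ s, |K u t| ≤ C) :
    ∫ u in a..x, sintegralOn μ s (K u) = sintegralOn μ s (fun t => ∫ u in a..x, K u t) := by
  have key := integrable_uncurry_prod_restrict hax hs hK hC
  simp only [sintegralOn]
  rw [intervalIntegral.integral_sub, intervalIntegral_integral_swap (key _),
    intervalIntegral_integral_swap (key _)] <;> rw [intervalIntegrable_iff]
  · exact (key _).integral_prod_left
  · exact (key _).integral_prod_left

end SignedIntegral

/-- The truncated power `(x - t)₊ ^ k / k!`, equal for `k = 0` to the indicator of `t ≤ x`. -/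
noncomputable def truncPow (k : ℕ) (x t : ℝ) : ℝ :=
  if t ≤ x then (x - t) ^ k / k.factorial else 0

lemma measurable_uncurry_truncPow (k : ℕ) : Measurable (Function.uncurry (truncPow k)) := by
  refine Measurable.ite (measurableSet_le measurable_snd measurable_fst) ?_ measurable_const
  fun_prop

lemma abs_truncPow_le {k : ℕ} {a b x t : ℝ} (hx : x ≤ b) (ht : a ≤ t) :
    |truncPow k x t| ≤ |b - a| ^ k := by
  unfold truncPow
  split_ifs with h
  · have h0 : 0 ≤ x - t := by linarith
    have h1 : x - t ≤ |b - a| := le_trans (by linarith) (le_abs_self _)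
    rw [abs_of_nonneg (by positivity)]
    calc (x - t) ^ k / k.factorial ≤ (x - t) ^ k :=
          div_le_self (by positivity) (by exact_mod_cast k.factorial_pos)
      _ ≤ _ := by gcongr
  · simp

lemma intervalIntegral_mul_truncPow {k : ℕ} {a x t : ℝ} (w : ℝ → ℝ) (ht : t ∈ Icc a x) :
    ∫ u in a..x, w u * truncPow k u t = ∫ u in t..x, w u * ((u - t) ^ k / k.factorial) := by
  rw [intervalIntegral.integral_of_le (ht.1.trans ht.2), intervalIntegral.integral_of_le ht.2,
    ← integral_Icc_eq_integral_Ioc, ← integral_Icc_eq_integral_Ioc,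
    setIntegral_eq_of_subset_of_forall_sdiff_eq_zero measurableSet_Icc
      (Icc_subset_Icc_left ht.1) (f := fun u => w u * truncPow k u t)]
  · refine setIntegral_congr_fun measurableSet_Icc fun u hu => ?_
    simp [truncPow, hu.1]
  · rintro u ⟨hu, hu'⟩
    have : ¬ t ≤ u := fun h => hu' ⟨h, hu.2⟩
    simp [truncPow, this]

lemma intervalIntegral_truncPow {k : ℕ} {a x t : ℝ} (hax : a ≤ x) (ht : a ≤ t) :
    ∫ u in a..x, truncPow k u t = truncPow (k + 1) x t := by
  rcases le_or_gt t x with htx | htx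
  · have := intervalIntegral_mul_truncPow (k := k) (fun _ => 1) ⟨ht, htx⟩
    simp only [one_mul] at this
    rw [this, intervalIntegral.integral_div, intervalIntegral.integral_comp_sub_right
      (fun u => u ^ k), integral_pow, truncPow, if_pos htx, Nat.factorial_succ]
    simp
    field_simp
  · rw [truncPow, if_neg htx.not_ge]
    refine (intervalIntegral.integral_congr fun u hu => ?_).trans intervalIntegral.integral_zero
    rw [uIcc_of_le hax] at hu
    simp [truncPow, (hu.2.trans_lt htx).not_ge]

lemma sintegralOn_truncPow_zero {μ : SignedMeasure ℝ} {a b : ℝ}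
    (hμ : ConcentratedOn μ (Ioc a b)) {x : ℝ} (hx : x ∈ Icc a b) :
    sintegralOn μ (Icc a b) (truncPow 0 x) = μ (Ioc a x) := by
  have key : ∀ (ν : Measure ℝ) [IsFiniteMeasure ν], ν ≤ μ.totalVariation →
      ∫ t in Icc a b, truncPow 0 x t ∂ν = ν.real (Ioc a x) := by
    intro ν _ hν
    have h0 : ν {a} = 0 := by
      refine measure_mono_null (t := (Ioc a b)ᶜ) (by simp) ?_
      exact le_antisymm ((hν _).trans hμ.le) bot_le
    have h1 : (truncPow 0 x) = (Iic x).indicator fun _ => (1 : ℝ) := by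
      ext t
      simp [truncPow, indicator]
    rw [h1, setIntegral_indicator measurableSet_Iic, setIntegral_const, smul_eq_mul, mul_one]
    refine measureReal_congr ?_
    rw [show Icc a b ∩ Iic x = Icc a x by ext t; grind [hx.2]]
    exact (Ioc_ae_eq_Icc' h0).symm
  rw [sintegralOn, key _ (posPart_le_totalVariation μ), key _ (negPart_le_totalVariation μ),
    μ.apply_eq_posPart_real_sub_negPart_real measurableSet_Ioc]

lemma iterInt_eq_sintegralOn {μ : SignedMeasure ℝ} {a b : ℝ}
    (hμ : ConcentratedOn μ (Ioc a b)) {F : ℝ → ℝ} (hF : ∀ x, F x = μ (Ioc a x)) (k : ℕ) :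
    ∀ x ∈ Icc a b, iterInt a F k x = sintegralOn μ (Icc a b) (truncPow k x) := by
  induction k with
  | zero => intro x hx; rw [sintegralOn_truncPow_zero hμ hx, ← hF]; rfl
  | succ k ih =>
    intro x hx
    have h1 : iterInt a F (k + 1) x = ∫ u in a..x, sintegralOn μ (Icc a b) (truncPow k u) := by
      refine intervalIntegral.integral_congr fun u hu => ih u ?_
      rw [uIcc_of_le hx.1] at hu
      exact ⟨hu.1, hu.2.trans hx.2⟩
    rw [h1, intervalIntegral_sintegralOn_swap hx.1 measurableSet_Icc
      (measurable_uncurry_truncPow k)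
      fun u hu t ht => abs_truncPow_le (hu.2.trans hx.2) ht.1]
    exact sintegralOn_congr measurableSet_Icc fun t ht => intervalIntegral_truncPow hx.1 ht.1

lemma contDiff_and_iteratedDeriv_eq (m : ℕ) :
    ∀ g : ℕ → ℝ → ℝ, (∀ i < m, ∀ x, HasDerivAt (g i) (g (i + 1) x) x) → Continuous (g m) →
      ContDiff ℝ m (g 0) ∧ iteratedDeriv m (g 0) = g m := by
  induction m with
  | zero => intro g _ hc; simpa using hc
  | succ m ih =>
    intro g hg hc
    obtain ⟨h1, h2⟩ := ih (fun i => g (i + 1)) (fun i hi => hg (i + 1) (by omega)) hc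
    have hd : deriv (g 0) = g 1 := funext fun x => (hg 0 (by omega) x).deriv
    refine ⟨?_, ?_⟩
    · push_cast
      rw [contDiff_succ_iff_deriv]
      refine ⟨fun x => (hg 0 (by omega) x).differentiableAt, by simp, ?_⟩
      rw [hd]
      exact h1
    · rw [iteratedDeriv_succ', hd]
      exact h2

lemma nConvexOn_of_hasDerivAt {m : ℕ} {a b : ℝ} (g : ℕ → ℝ → ℝ)
    (hg : ∀ i < m, ∀ x, HasDerivAt (g i) (g (i + 1) x) x) (hcont : Continuous (g m))
    (hconv : ConvexOn ℝ univ (g m)) : NConvexOn (m + 1) a b (g 0) := by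
  obtain ⟨h1, h2⟩ := contDiff_and_iteratedDeriv_eq m g hg hcont
  refine ⟨h1.contDiffOn, ?_⟩
  rw [Nat.add_sub_cancel]
  refine (hconv.subset (subset_univ _) (convex_Ioo a b)).congr fun x hx => ?_
  rw [iteratedDerivWithin_of_isOpen isOpen_Ioo hx, h2]

lemma nConvexOn_const_mul_sub_pow {m k : ℕ} (hk : k ≤ m + 1) (a b c d : ℝ) :
    NConvexOn (m + 1) a b (fun t => c * (d - t) ^ k) := by
  have := nConvexOn_of_hasDerivAt (m := m) (a := a) (b := b)
    (fun i t => c * (-1) ^ i * k.descFactorial i * (d - t) ^ (k - i)) ?_ (by fun_prop) ?_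
  · simpa using this
  · intro i _ x
    convert! (((hasDerivAt_id' x).const_sub d).pow (k - i)).const_mul
      (c * (-1) ^ i * k.descFactorial i) using 1
    rw [Nat.descFactorial_succ, Nat.sub_sub]
    push_cast
    ring
  · have h01 : k - m = 0 ∨ k - m = 1 := by omega
    refine ⟨convex_univ, fun x _ y _ u v _ _ huv => le_of_eq ?_⟩
    obtain rfl : v = 1 - u := by linarith
    rcases h01 with h | h <;> simp only [h, smul_eq_mul] <;> ring

lemma hasDerivAt_max_zero_pow (j : ℕ) (t : ℝ) :
    HasDerivAt (fun t : ℝ => max t 0 ^ (j + 2)) ((j + 2) * max t 0 ^ (j + 1)) t := by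
  have hpow : HasDerivAt (fun t : ℝ => t ^ (j + 2)) ((j + 2) * t ^ (j + 1)) t := by
    simpa using hasDerivAt_pow (j + 2) t
  rcases lt_trichotomy t 0 with ht | rfl | ht
  · rw [max_eq_right ht.le]
    refine ((hasDerivAt_const t (0 : ℝ)).congr_of_eventuallyEq ?_).congr_deriv (by simp)
    filter_upwards [Iio_mem_nhds ht] with s hs
    simp [max_eq_right (show s ≤ 0 from le_of_lt hs)]
  · have h1 : HasDerivWithinAt (fun t : ℝ => max t 0 ^ (j + 2)) 0 (Ici 0) 0 := by
      refine (hpow.hasDerivWithinAt.congr_deriv (by simp)).congr (fun s hs => ?_) (by simp)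
      simp [max_eq_left (mem_Ici.mp hs)]
    have h2 : HasDerivWithinAt (fun t : ℝ => max t 0 ^ (j + 2)) 0 (Iic 0) 0 := by
      refine (hasDerivWithinAt_const 0 _ (0 : ℝ)).congr (fun s hs => ?_) (by simp)
      simp [max_eq_right (mem_Iic.mp hs)]
    have h3 := h2.union h1
    rw [Iic_union_Ici, hasDerivWithinAt_univ] at h3
    simpa using h3
  · rw [max_eq_left ht.le]
    refine hpow.congr_of_eventuallyEq ?_
    filter_upwards [Ioi_mem_nhds ht] with s hs
    simp [max_eq_left (show 0 ≤ s from le_of_lt hs)]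

lemma truncPow_succ_eq (k : ℕ) (x t : ℝ) :
    truncPow (k + 1) x t = max (x - t) 0 ^ (k + 1) / (k + 1).factorial := by
  unfold truncPow
  split_ifs with h
  · rw [max_eq_left (by linarith)]
  · rw [max_eq_right (by linarith)]
    simp

lemma hasDerivAt_truncPow (k : ℕ) (x t : ℝ) :
    HasDerivAt (truncPow (k + 2) x) (-truncPow (k + 1) x t) t := by
  rw [funext (truncPow_succ_eq (k + 1) x), truncPow_succ_eq]
  convert! (((hasDerivAt_max_zero_pow k (x - t)).scomp t
    ((hasDerivAt_id' t).const_sub x)).div_const ((k + 1 + 1).factorial : ℝ)) using 1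
  rw [Nat.factorial_succ (k + 1), smul_eq_mul]
  push_cast
  have : ((k + 1).factorial : ℝ) ≠ 0 := by positivity
  field_simp
  ring

lemma continuous_truncPow_succ (k : ℕ) (x : ℝ) : Continuous (truncPow (k + 1) x) := by
  rw [funext (truncPow_succ_eq k x)]
  fun_prop

lemma nConvexOn_truncPow (m : ℕ) (a b x : ℝ) :
    NConvexOn (m + 1) a b (fun t => (-1) ^ m * truncPow (m + 1) x t) := by
  have := nConvexOn_of_hasDerivAt (m := m) (a := a) (b := b)
    (fun i t => (-1) ^ (m + i) * truncPow (m + 1 - i) x t) ?_ ?_ ?_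
  · simpa using this
  · intro i hi t
    obtain ⟨j, rfl⟩ : ∃ j, m = i + 1 + j := ⟨m - (i + 1), by omega⟩
    rw [show i + 1 + j + 1 - i = j + 2 by omega, show i + 1 + j + 1 - (i + 1) = j + 1 by omega]
    convert! (hasDerivAt_truncPow j x t).const_mul ((-1) ^ (i + 1 + j + i)) using 1
    ring
  · rw [show m + 1 - m = 0 + 1 by omega]
    exact (continuous_truncPow_succ 0 x).const_mul _
  · rw [show m + 1 - m = 0 + 1 by omega, ← two_mul, pow_mul]
    simp only [truncPow_succ_eq]
    simp only [zero_add, pow_one, even_two, Even.neg_pow, one_pow, one_mul, Nat.factorial_one,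
      Nat.cast_one, div_one]
    refine ConvexOn.sup ⟨convex_univ, fun y _ z _ u v _ _ huv => le_of_eq ?_⟩
      (convexOn_const 0 convex_univ)
    obtain rfl : v = 1 - u := by linarith
    simp only [smul_eq_mul]
    ring

lemma taylor_expansion_right {q : ℕ → ℝ → ℝ} (hq : ∀ i x, HasDerivAt (q i) (q (i + 1) x) x)
    (b t : ℝ) (n : ℕ) :
    q 0 t = ∑ k ∈ Finset.range (n + 1), q k b * (-1) ^ k * ((b - t) ^ k / k.factorial) +
      (-1) ^ (n + 1) * ∫ u in t..b, q (n + 1) u * ((u - t) ^ n / n.factorial) := by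
  have hcont : ∀ i, Continuous (q i) := fun i =>
    continuous_iff_continuousAt.2 fun x => (hq i x).continuousAt
  induction n with
  | zero =>
    have := intervalIntegral.integral_eq_sub_of_hasDerivAt (fun x _ => hq 0 x)
      ((hcont 1).intervalIntegrable t b)
    simp [this]
  | succ n ih =>
    have hv : ∀ u : ℝ, HasDerivAt (fun u => (u - t) ^ (n + 1) / (n + 1).factorial)
        ((u - t) ^ n / n.factorial) u := by
      intro u
      convert! (((hasDerivAt_id' u).sub_const t).pow (n + 1)).div_const
        ((n + 1).factorial : ℝ) using 1
      rw [Nat.factorial_succ]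
      have : (n.factorial : ℝ) ≠ 0 := by positivity
      push_cast
      field_simp
    have := intervalIntegral.integral_mul_deriv_eq_deriv_mul (a := t) (b := b)
      (fun u _ => hq (n + 1) u) (fun u _ => hv u) ((hcont (n + 2)).intervalIntegrable t b)
      (Continuous.intervalIntegrable (by fun_prop) t b)
    rw [ih, this, Finset.sum_range_succ _ (n + 1)]
    simp
    ring

lemma integrableOn_truncPow (ν : Measure ℝ) [IsFiniteMeasure ν] {a b x : ℝ} (hx : x ≤ b)
    (k : ℕ) : IntegrableOn (truncPow k x) (Icc a b) ν := by
  have hm : Measurable (truncPow k x) :=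
    (measurable_uncurry_truncPow k).comp (measurable_const.prodMk measurable_id)
  refine Integrable.of_bound hm.aestronglyMeasurable (|b - a| ^ k) ?_
  filter_upwards [ae_restrict_mem measurableSet_Icc] with t ht using abs_truncPow_le hx ht.1

section Representation

variable {μ : SignedMeasure ℝ} {a b : ℝ} {w : ℝ → ℝ}

lemma exists_abs_mul_truncPow_le (hw : Continuous w) (a b : ℝ) (n : ℕ) :
    ∃ C, ∀ u ∈ Ioc a b, ∀ t ∈ Icc a b, |w u * truncPow n u t| ≤ C := by
  obtain ⟨C, hC⟩ := (isCompact_Icc (a := a) (b := b)).exists_bound_of_continuousOn hw.continuousOn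
  refine ⟨C * |b - a| ^ n, fun u hu t ht => ?_⟩
  rw [abs_mul]
  have h1 := hC u ⟨hu.1.le, hu.2⟩
  exact mul_le_mul h1 (abs_truncPow_le hu.2 ht.1) (abs_nonneg _) ((norm_nonneg _).trans h1)

lemma measurable_uncurry_mul_truncPow (hw : Continuous w) (n : ℕ) :
    Measurable (Function.uncurry fun u t => w u * truncPow n u t) :=
  (hw.measurable.comp measurable_fst).mul (measurable_uncurry_truncPow n)

lemma intervalIntegrable_mul_sintegralOn_truncPow (hab : a ≤ b) (hw : Continuous w) (n : ℕ) :
    IntervalIntegrable (fun u => w u * sintegralOn μ (Icc a b) (truncPow n u)) volume a b := by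
  obtain ⟨C, hC⟩ := exists_abs_mul_truncPow_le hw a b n
  simp only [← sintegralOn_const_mul]
  exact intervalIntegrable_sintegralOn hab measurableSet_Icc
    (measurable_uncurry_mul_truncPow hw n) hC

lemma sintegralOn_eq_sum_add_integral {q : ℕ → ℝ → ℝ} (hab : a ≤ b)
    (hq : ∀ i x, HasDerivAt (q i) (q (i + 1) x) x) (n : ℕ) :
    sintegralOn μ (Icc a b) (q 0) =
      ∑ k ∈ Finset.range (n + 1), q k b * (-1) ^ k * sintegralOn μ (Icc a b) (truncPow k b) +
      (-1) ^ (n + 1) * ∫ u in a..b, q (n + 1) u * sintegralOn μ (Icc a b) (truncPow n u) := by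
  have hcont : ∀ i, Continuous (q i) := fun i =>
    continuous_iff_continuousAt.2 fun x => (hq i x).continuousAt
  obtain ⟨C, hC⟩ := exists_abs_mul_truncPow_le (hcont (n + 1)) a b n
  have hK := measurable_uncurry_mul_truncPow (hcont (n + 1)) n
  have hpt : EqOn (q 0) (fun t => ∑ k ∈ Finset.range (n + 1), q k b * (-1) ^ k * truncPow k b t +
      (-1) ^ (n + 1) * ∫ u in a..b, q (n + 1) u * truncPow n u t) (Icc a b) := by
    intro t ht
    simp only
    rw [taylor_expansion_right hq b t n, intervalIntegral_mul_truncPow _ ht]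
    simp [truncPow, ht.2]
  have hint : ∀ k ∈ Finset.range (n + 1),
      IntegrableOn (fun t => q k b * (-1) ^ k * truncPow k b t) (Icc a b) μ.totalVariation :=
    fun k _ => (integrableOn_truncPow _ le_rfl k).const_mul _
  have hint' : IntegrableOn (fun t => (-1) ^ (n + 1) * ∫ u in a..b, q (n + 1) u * truncPow n u t)
      (Icc a b) μ.totalVariation := by
    have := (integrable_uncurry_prod_restrict hab measurableSet_Icc hK hC
      μ.totalVariation).integral_prod_right
    rw [uIoc_of_le hab] at this
    simp only [intervalIntegral.integral_of_le hab]
    exact this.const_mul _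
  rw [sintegralOn_congr measurableSet_Icc hpt,
    sintegralOn_add (integrable_finsetSum _ hint) hint', sintegralOn_sum _ hint]
  simp only [sintegralOn_const_mul]
  rw [← intervalIntegral_sintegralOn_swap hab measurableSet_Icc hK hC]
  simp only [sintegralOn_const_mul]

end Representation

lemma sintegralOn_le_of_derivative_nonneg {μ₁ μ₂ : SignedMeasure ℝ} {a b : ℝ} (hab : a ≤ b) {n : ℕ}
    (hmom : ∀ k ≤ n, sintegralOn μ₁ (Icc a b) (truncPow k b) =
      sintegralOn μ₂ (Icc a b) (truncPow k b))
    (hineq : ∀ x ∈ Ioo a b, (-1) ^ (n + 1) * sintegralOn μ₁ (Icc a b) (truncPow n x) ≤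
      (-1) ^ (n + 1) * sintegralOn μ₂ (Icc a b) (truncPow n x))
    {q : ℕ → ℝ → ℝ} (hq : ∀ i x, HasDerivAt (q i) (q (i + 1) x) x)
    (hpos : ∀ x ∈ Icc a b, 0 ≤ q (n + 1) x) :
    sintegralOn μ₁ (Icc a b) (q 0) ≤ sintegralOn μ₂ (Icc a b) (q 0) := by
  have hcont : Continuous (q (n + 1)) :=
    continuous_iff_continuousAt.2 fun x => (hq _ x).continuousAt
  rw [sintegralOn_eq_sum_add_integral hab hq n, sintegralOn_eq_sum_add_integral hab hq n]
  refine add_le_add (le_of_eq (Finset.sum_congr rfl fun k hk => ?_)) ?_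
  · rw [hmom k (Nat.lt_succ_iff.mp (Finset.mem_range.mp hk))]
  · rw [← intervalIntegral.integral_const_mul, ← intervalIntegral.integral_const_mul]
    refine intervalIntegral.integral_mono_on_of_le_Ioo hab
      ((intervalIntegrable_mul_sintegralOn_truncPow hab hcont n).const_mul _)
      ((intervalIntegrable_mul_sintegralOn_truncPow hab hcont n).const_mul _) fun x hx => ?_
    rw [mul_left_comm, mul_left_comm _ (q (n + 1) x)]
    exact mul_le_mul_of_nonneg_left (hineq x hx) (hpos x (Ioo_subset_Icc_self hx))

open Polynomial in
lemma NConvexOn.sintegralOn_le {μ₁ μ₂ : SignedMeasure ℝ} {a b : ℝ} (hab : a < b) {n : ℕ}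
    (hn : 1 ≤ n)
    (hmom : ∀ k ≤ n, sintegralOn μ₁ (Icc a b) (truncPow k b) =
      sintegralOn μ₂ (Icc a b) (truncPow k b))
    (hineq : ∀ x ∈ Ioo a b, (-1) ^ (n + 1) * sintegralOn μ₁ (Icc a b) (truncPow n x) ≤
      (-1) ^ (n + 1) * sintegralOn μ₂ (Icc a b) (truncPow n x))
    {f : ℝ → ℝ} (hf : NConvexOn n a b f) (hc : ContinuousOn f (Icc a b)) :
    sintegralOn μ₁ (Icc a b) f ≤ sintegralOn μ₂ (Icc a b) f := by
  have hba : 0 < b - a := sub_pos.2 hab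
  set B : ℕ → ℝ[X] := fun N => bernsteinSum N fun j => f (a + j * ((b - a) / N))
  set q : ℕ → ℕ → ℝ → ℝ := fun N i t =>
    (b - a)⁻¹ ^ i * (derivative^[i] (B N)).eval ((t - a) / (b - a))
  have hq : ∀ N i x, HasDerivAt (q N i) (q N (i + 1) x) x := by
    intro N i x
    convert! (((derivative^[i] (B N)).hasDerivAt ((x - a) / (b - a))).scomp x
      (((hasDerivAt_id' x).sub_const a).div_const (b - a))).const_mul ((b - a)⁻¹ ^ i) using 1
    simp only [q, Function.iterate_succ_apply', smul_eq_mul]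
    ring
  have hunit : ∀ x ∈ Icc a b, (x - a) / (b - a) ∈ Icc (0 : ℝ) 1 := fun x hx =>
    ⟨div_nonneg (by linarith [hx.1]) hba.le, (div_le_one hba).2 (by linarith [hx.2])⟩
  have hpos : ∀ N, ∀ x ∈ Icc a b, 0 ≤ q N (n + 1) x := by
    intro N x hx
    refine mul_nonneg (by positivity) (iterate_derivative_bernsteinSum_nonneg _ _ _
      (fun k hk => ?_) _ (hunit x hx))
    rw [fwdDiff_iter_comp_affine]
    have hN : (0 : ℝ) < N := by exact_mod_cast (show 0 < N by omega)
    refine hf.fwdDiff_iter_nonneg_of_continuousOn hn hab (by positivity) hc _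
      (le_add_of_nonneg_right (by positivity)) ?_
    have hk' : (k : ℝ) + (n + 1 : ℕ) ≤ N := by exact_mod_cast hk
    have h1 : ((k : ℝ) + (n + 1 : ℕ)) * ((b - a) / N) ≤ N * ((b - a) / N) := by gcongr
    rw [mul_div_cancel₀ _ hN.ne'] at h1
    linarith
  let F : C(unitInterval, ℝ) := ⟨fun s => f (a + (b - a) * s), by
    refine hc.comp_continuous (by fun_prop) fun s => ⟨?_, ?_⟩
    · nlinarith [s.2.1]
    · nlinarith [s.2.2]⟩
  have hqF : ∀ N, ∀ t (ht : t ∈ Icc a b),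
      q N 0 t = bernsteinApproximation N F ⟨(t - a) / (b - a), hunit t ht⟩ := by
    intro N t ht
    rw [bernsteinApproximation.apply]
    simp only [q, B, bernsteinSum, pow_zero, one_mul, Function.iterate_zero_apply,
      eval_finsetSum, Finset.sum_range, eval_mul, eval_C]
    refine Finset.sum_congr rfl fun k _ => ?_
    rw [smul_eq_mul, mul_comm]
    congr 1
    change _ = f (a + (b - a) * ((k : ℝ) / N))
    congr 2
    ring
  have hlim := bernsteinApproximation_uniform F
  have hbd : ∀ᶠ N in Filter.atTop, ∀ t ∈ Icc a b, |q N 0 t| ≤ ‖F‖ + 1 := by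
    filter_upwards [hlim.norm.eventually_le_const (lt_add_one ‖F‖)] with N hN t ht
    rw [hqF N t ht]
    exact (ContinuousMap.norm_coe_le_norm _ _).trans hN
  have hpt : ∀ t ∈ Icc a b, Filter.Tendsto (fun N => q N 0 t) Filter.atTop (nhds (f t)) := by
    intro t ht
    simp only [hqF _ t ht]
    have h1 := ((continuous_eval_const
      (⟨(t - a) / (b - a), hunit t ht⟩ : unitInterval)).tendsto F).comp hlim
    have h2 : F ⟨(t - a) / (b - a), hunit t ht⟩ = f t := by
      change f (a + (b - a) * ((t - a) / (b - a))) = f t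
      rw [mul_div_cancel₀ _ hba.ne', add_sub_cancel]
    rw [h2] at h1
    exact h1
  have hcont : ∀ N, ContinuousOn (q N 0) (Icc a b) := fun N x _ =>
    (hq N 0 x).continuousAt.continuousWithinAt
  exact le_of_tendsto_of_tendsto' (tendsto_sintegralOn_of_bounded measurableSet_Icc hcont hbd hpt)
    (tendsto_sintegralOn_of_bounded measurableSet_Icc hcont hbd hpt) fun N =>
      sintegralOn_le_of_derivative_nonneg hab.le hmom hineq (hq N) (hpos N)

/-- **Generalized Levin–Stečkin theorem (Theorem 2.1).**
For signed measures `μ₁, μ₂` concentrated on `(a,b]` with distribution functions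
`F₁, F₂`, the inequality `∫ f dμ₁ ≤ ∫ f dμ₂` holds for all continuous `n`-convex `f`
iff the stated moment-type equalities and the iterated-integral inequality hold. -/
theorem statement0 (a b : ℝ) (hab : a < b) (n : ℕ) (hn : 1 ≤ n)
    (μ₁ μ₂ : SignedMeasure ℝ)
    (hμ₁ : ConcentratedOn μ₁ (Ioc a b)) (hμ₂ : ConcentratedOn μ₂ (Ioc a b))
    (F₁ F₂ : ℝ → ℝ)
    (hF₁ : ∀ x, F₁ x = μ₁ (Ioc a x)) (hF₂ : ∀ x, F₂ x = μ₂ (Ioc a x)) :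
    (∀ f : ℝ → ℝ, ContinuousOn f (Icc a b) → NConvexOn n a b f →
        sintegralOn μ₁ (Icc a b) f ≤ sintegralOn μ₂ (Icc a b) f) ↔
      (F₁ b = F₂ b ∧
        (∫ x in a..b, F₁ x) = (∫ x in a..b, F₂ x) ∧
        (∀ k, 2 ≤ k → k ≤ n → iterInt a F₁ k b = iterInt a F₂ k b) ∧
        (∀ x ∈ Ioo a b,
          (-1 : ℝ) ^ (n + 1) * iterInt a F₁ n x ≤ (-1 : ℝ) ^ (n + 1) * iterInt a F₂ n x)) := by
  have hb : b ∈ Icc a b := right_mem_Icc.2 hab.le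
  have h₁ := iterInt_eq_sintegralOn hμ₁ hF₁
  have h₂ := iterInt_eq_sintegralOn hμ₂ hF₂
  constructor
  · intro H
    obtain ⟨m, rfl⟩ : ∃ m, n = m + 1 := ⟨n - 1, by omega⟩
    have hmom : ∀ k ≤ m + 1, iterInt a F₁ k b = iterInt a F₂ k b := by
      intro k hk
      have key : ∀ c : ℝ, c * iterInt a F₁ k b ≤ c * iterInt a F₂ k b := by
        intro c
        have heq : EqOn (fun t => c * truncPow k b t)
            (fun t => c / k.factorial * (b - t) ^ k) (Icc a b) := by
          intro t ht
          simp only [truncPow, if_pos ht.2]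
          ring
        rw [h₁ k b hb, h₂ k b hb, ← sintegralOn_const_mul, ← sintegralOn_const_mul,
          sintegralOn_congr measurableSet_Icc heq, sintegralOn_congr measurableSet_Icc heq]
        exact H _ (by fun_prop) (nConvexOn_const_mul_sub_pow hk a b _ b)
      linarith [key 1, key (-1)]
    refine ⟨hmom 0 (by omega), hmom 1 (by omega), fun k _ hk => hmom k hk, fun x hx => ?_⟩
    rw [h₁ _ x (Ioo_subset_Icc_self hx), h₂ _ x (Ioo_subset_Icc_self hx),
      ← sintegralOn_const_mul, ← sintegralOn_const_mul, pow_succ, pow_succ]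
    simp only [mul_neg, mul_one, neg_neg]
    exact H _ ((continuous_truncPow_succ m x).const_mul _).continuousOn (nConvexOn_truncPow m a b x)
  · rintro ⟨H0, H1, Hk, Hx⟩ f hc hf
    refine hf.sintegralOn_le hab hn (fun k hk => ?_) (fun x hx => ?_) hc
    · rw [← h₁ k b hb, ← h₂ k b hb]
      match k, hk with
      | 0, _ => exact H0
      | 1, _ => exact H1
      | k + 2, hk => exact Hk (k + 2) (by omega) hk
    · rw [← h₁ n x (Ioo_subset_Icc_self hx), ← h₂ n x (Ioo_subset_Icc_self hx)]
      exact Hx x hx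
end

section
/- Let a < b be real numbers, let μ be a finite signed measure on ℝ concentrated on (a,b] with distribution function F(x) = μ((a,x]), and let f : [a,b] → ℝ be continuous on [a,b] and twice continuously differentiable on (a,b) with f′, f″ integrable. Then ∫_{[a,b]} f dμ = [F(x) f(x)]_{x=a}^{x=b} − [ (∫_a^x F(t) dt) f′(x) ]_{x=a}^{x=b} + ∫_a^b (∫_a^x F(t) dt) f″(x) dx. -/
open MeasureTheory Set

/-- Integration by parts against `g ∂ν`: the primitive of `g ∂ν` based at `a` is the right-continuous
one, and `f` is a primitive of an integrable function on `[a, b]`. -/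
theorem setIntegral_Ioc_mul_eq_sub {a b : ℝ} (hab : a ≤ b) {ν : Measure ℝ} [SFinite ν]
    {f f' g : ℝ → ℝ} (hf : ContinuousOn f (Icc a b))
    (hderiv : ∀ x ∈ Ioo a b, HasDerivAt f (f' x) x)
    (hint : IntervalIntegrable f' volume a b) (hg : IntegrableOn g (Ioc a b) ν) :
    ∫ x in Ioc a b, g x * f x ∂ν =
      (∫ x in Ioc a b, g x ∂ν) * f b - ∫ t in a..b, (∫ x in Ioc a t, g x ∂ν) * f' t := by
  have hint_Ioc : IntegrableOn f' (Ioc a b) := (intervalIntegrable_iff_integrableOn_Ioc_of_le hab).1 hint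
  have hset : MeasurableSet {p : ℝ × ℝ | p.1 ≤ p.2} := measurableSet_le measurable_fst measurable_snd
  have hker : Integrable ({p : ℝ × ℝ | p.1 ≤ p.2}.indicator fun p => g p.1 * f' p.2)
      ((ν.restrict (Ioc a b)).prod (volume.restrict (Ioc a b))) :=
    (hg.mul_prod hint_Ioc).indicator hset
  have hswap := integral_integral_swap
    (f := fun x t => {p : ℝ × ℝ | p.1 ≤ p.2}.indicator (fun p => g p.1 * f' p.2) (x, t)) hker
  have hleft : ∀ x ∈ Ioc a b,
      ∫ t in Ioc a b, {p : ℝ × ℝ | p.1 ≤ p.2}.indicator (fun p => g p.1 * f' p.2) (x, t)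
        = g x * f b - g x * f x := by
    intro x hx
    have hftc : ∫ t in x..b, f' t = f b - f x :=
      intervalIntegral.integral_eq_sub_of_hasDerivAt_of_le hx.2
        (hf.mono (Icc_subset_Icc_left hx.1.le))
        (fun y hy => hderiv y ⟨hx.1.trans hy.1, hy.2⟩)
        (hint.mono_set (by
          rw [uIcc_of_le hx.2, uIcc_of_le hab]; exact Icc_subset_Icc_left hx.1.le))
    have hind : (fun t => {p : ℝ × ℝ | p.1 ≤ p.2}.indicator (fun p => g p.1 * f' p.2) (x, t))
        = (Ici x).indicator fun t => g x * f' t := by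
      ext t; simp [indicator]
    have hinter : Ioc a b ∩ Ici x = Icc x b := by
      ext t
      simp only [mem_inter_iff, mem_Ioc, mem_Ici, mem_Icc]
      exact ⟨fun h => ⟨h.2, h.1.2⟩, fun h => ⟨⟨hx.1.trans_le h.1, h.2⟩, h.1⟩⟩
    rw [hind, setIntegral_indicator measurableSet_Ici, hinter, integral_Icc_eq_integral_Ioc,
      ← intervalIntegral.integral_of_le hx.2, intervalIntegral.integral_const_mul, hftc, mul_sub]
  have hright : ∀ t ∈ Ioc a b,
      ∫ x in Ioc a b, {p : ℝ × ℝ | p.1 ≤ p.2}.indicator (fun p => g p.1 * f' p.2) (x, t) ∂ν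
        = (∫ x in Ioc a t, g x ∂ν) * f' t := by
    intro t ht
    have hind : (fun x => {p : ℝ × ℝ | p.1 ≤ p.2}.indicator (fun p => g p.1 * f' p.2) (x, t))
        = (Iic t).indicator fun x => g x * f' t := by
      ext x; simp [indicator]
    have hinter : Ioc a b ∩ Iic t = Ioc a t := by
      rw [Ioc_inter_Iic, min_eq_right ht.2]
    rw [hind, setIntegral_indicator measurableSet_Iic, hinter, integral_mul_const]
  rw [setIntegral_congr_fun measurableSet_Ioc hleft,
    setIntegral_congr_fun measurableSet_Ioc hright] at hswap
  have hgf : IntegrableOn (fun x => g x * f x) (Ioc a b) ν := by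
    obtain ⟨C, hC⟩ := isCompact_Icc.exists_bound_of_continuousOn hf
    refine Integrable.mul_bdd (c := C) hg
      ((hf.mono Ioc_subset_Icc_self).aestronglyMeasurable measurableSet_Ioc) ?_
    exact ae_restrict_of_forall_mem measurableSet_Ioc fun x hx => hC x (Ioc_subset_Icc_self hx)
  rw [integral_sub (hg.mul_const _) hgf, integral_mul_const] at hswap
  rw [intervalIntegral.integral_of_le hab]
  linarith

theorem setIntegral_Icc_eq_sub_of_isFiniteMeasure {a b : ℝ} (hab : a ≤ b) {ν : Measure ℝ}
    [IsFiniteMeasure ν] (ha : ν {a} = 0) {f f' : ℝ → ℝ} (hf : ContinuousOn f (Icc a b))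
    (hderiv : ∀ x ∈ Ioo a b, HasDerivAt f (f' x) x)
    (hint : IntervalIntegrable f' volume a b) :
    ∫ x in Icc a b, f x ∂ν =
      ν.real (Ioc a b) * f b - ∫ t in a..b, ν.real (Ioc a t) * f' t := by
  rw [integral_Icc_eq_integral_Ioc' ha]
  simpa using setIntegral_Ioc_mul_eq_sub hab hf hderiv hint
    (integrableOn_const (μ := ν) (C := (1 : ℝ)) (measure_ne_top _ _))

theorem monotone_measureReal_Ioc (ν : Measure ℝ) [IsFiniteMeasure ν] (a : ℝ) :
    Monotone fun t => ν.real (Ioc a t) :=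
  fun _ _ h => measureReal_mono (Ioc_subset_Ioc_right h)

theorem intervalIntegrable_measureReal_Ioc_mul (ν : Measure ℝ) [IsFiniteMeasure ν] {a b : ℝ}
    {g : ℝ → ℝ} (hg : IntervalIntegrable g volume a b) :
    IntervalIntegrable (fun t => ν.real (Ioc a t) * g t) volume a b := by
  refine intervalIntegrable_iff.2 <| (intervalIntegrable_iff.1 hg).bdd_mul (c := ν.real univ)
    (monotone_measureReal_Ioc ν a).measurable.aestronglyMeasurable (.of_forall fun t => ?_)
  rw [Real.norm_of_nonneg measureReal_nonneg]
  exact measureReal_mono (subset_univ _)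

/-- **Two-fold integration by parts for a signed measure (Lemma 2.2, formula (2.7)).**
`∫_{[a,b]} f dμ = [F f]_a^b − [ (∫_a^x F) f′ ]_a^b + ∫_a^b (∫_a^x F) f″(x) dx`. -/
theorem statement2 (a b : ℝ) (hab : a < b) (μ : SignedMeasure ℝ)
    (hμ : ConcentratedOn μ (Ioc a b))
    (F : ℝ → ℝ) (hF : ∀ x, F x = μ (Ioc a x))
    (f f' f'' : ℝ → ℝ)
    (hf : ContinuousOn f (Icc a b))
    (hderiv : ∀ x ∈ Ioo a b, HasDerivAt f (f' x) x)
    (hf' : ContinuousOn f' (Icc a b))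
    (hderiv' : ∀ x ∈ Ioo a b, HasDerivAt f' (f'' x) x)
    (hf'' : ContinuousOn f'' (Ioo a b))
    (hint' : IntervalIntegrable f' volume a b)
    (hint'' : IntervalIntegrable f'' volume a b) :
    sintegralOn μ (Icc a b) f =
      (F b * f b - F a * f a)
        - ((∫ t in a..b, F t) * f' b - (∫ t in a..a, F t) * f' a)
        + ∫ x in a..b, (∫ t in a..x, F t) * f'' x := by
  have hab' := hab.le
  have ha : μ.totalVariation {a} = 0 := measure_mono_null (by simp) hμ
  rw [SignedMeasure.totalVariation, Measure.add_apply, add_eq_zero] at ha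
  have hF_eq (t : ℝ) : F t = μ.toJordanDecomposition.posPart.real (Ioc a t) -
      μ.toJordanDecomposition.negPart.real (Ioc a t) := by
    rw [hF, μ.apply_eq_posPart_real_sub_negPart_real measurableSet_Ioc]
  have hF_int : IntervalIntegrable F volume a b := by
    rw [funext hF_eq]
    exact (monotone_measureReal_Ioc _ a).intervalIntegrable.sub
      (monotone_measureReal_Ioc _ a).intervalIntegrable
  have hfirst : sintegralOn μ (Icc a b) f = F b * f b - ∫ t in a..b, F t * f' t := by
    simp only [hF_eq, sub_mul]
    rw [sintegralOn, setIntegral_Icc_eq_sub_of_isFiniteMeasure hab' ha.1 hf hderiv hint',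
      setIntegral_Icc_eq_sub_of_isFiniteMeasure hab' ha.2 hf hderiv hint',
      intervalIntegral.integral_sub (intervalIntegrable_measureReal_Ioc_mul _ hint')
        (intervalIntegrable_measureReal_Ioc_mul _ hint')]
    ring
  have hsecond : ∫ t in a..b, F t * f' t =
      (∫ t in a..b, F t) * f' b - ∫ x in a..b, (∫ t in a..x, F t) * f'' x := by
    have h := setIntegral_Ioc_mul_eq_sub hab' hf' hderiv' hint''
      ((intervalIntegrable_iff_integrableOn_Ioc_of_le hab').1 hF_int)
    rw [← intervalIntegral.integral_of_le hab', ← intervalIntegral.integral_of_le hab'] at h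
    rw [h]
    congr 1
    refine intervalIntegral.integral_congr fun x hx => ?_
    rw [uIcc_of_le hab'] at hx
    simp only [intervalIntegral.integral_of_le hx.1]
  have hFa : F a = 0 := by simp [hF]
  rw [hfirst, hsecond, hFa, intervalIntegral.integral_same]
  ring
end

section
/- Let a < b be real numbers and n ≥ 1 a natural number. Let μ₁, μ₂ be finite signed measures on ℝ concentrated on (a,b) such that ∫ |x|^n d|μᵢ| < ∞ for i = 1, 2. Then ∫_{[a,b]} f dμ₁ ≤ ∫_{[a,b]} f dμ₂ for every continuous n-convex function f : [a,b] → ℝ if and only if: (i) μ₁((a,b)) = μ₂((a,b)); (ii) ∫ x^k dμ₁(x) = ∫ x^k dμ₂(x) for every k = 1, …, n; and (iii) ∫ (t − x)₊ⁿ dμ₁(t) ≤ ∫ (t − x)₊ⁿ dμ₂(t) for every x ∈ (a,b), where y₊ⁿ = (max{y, 0})ⁿ. -/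
open MeasureTheory Set

lemma hasDerivAt_max_sub_zero_pow {n : ℕ} (hn : 1 ≤ n) (x t : ℝ) :
    HasDerivAt (fun t : ℝ => max (t - x) 0 ^ (n + 1)) ((n + 1) * max (t - x) 0 ^ n) t := by
  rcases lt_trichotomy t x with h | rfl | h
  · have h0 : max (t - x) 0 = 0 := max_eq_right (by linarith)
    rw [h0, zero_pow (by omega), mul_zero]
    refine (hasDerivAt_const t (0 : ℝ)).congr_of_eventuallyEq ?_
    filter_upwards [Iio_mem_nhds h] with y hy
    rw [max_eq_right (by linarith [mem_Iio.1 hy]), zero_pow (by omega)]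
  · have hO : (fun y : ℝ => max (y - t) 0 ^ (n + 1)) =O[nhds t] fun y => ‖y - t‖ ^ (n + 1) := by
      refine Asymptotics.IsBigO.of_norm_le fun y => ?_
      rw [norm_pow]
      refine pow_le_pow_left₀ (norm_nonneg _) ?_ _
      rw [Real.norm_of_nonneg (le_max_right _ _)]
      exact max_le (le_abs_self _) (abs_nonneg _)
    have h := (hO.hasFDerivAt (𝕜 := ℝ) (by omega)).hasDerivAt
    simpa [zero_pow (show n ≠ 0 by omega)] using h
  · have h0 : max (t - x) 0 = t - x := max_eq_left (by linarith)
    rw [h0]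
    have h1 := (hasDerivAt_pow (n + 1) (t - x)).comp t ((hasDerivAt_id t).sub_const x)
    have h2 : HasDerivAt (fun y : ℝ => (y - x) ^ (n + 1)) ((n + 1) * (t - x) ^ n) t := by
      simpa [Function.comp_def] using h1
    refine h2.congr_of_eventuallyEq ?_
    filter_upwards [Ioi_mem_nhds h] with y hy
    rw [max_eq_left (by linarith [mem_Ioi.1 hy])]

/-! ### `n`-convex functions -/

lemma nConvexOn_one {a b : ℝ} {f : ℝ → ℝ} : NConvexOn 1 a b f ↔ ConvexOn ℝ (Ioo a b) f := by
  have h0 : iteratedDerivWithin 0 f (Ioo a b) = f := iteratedDerivWithin_zero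
  simp only [NConvexOn, Nat.sub_self, h0]
  refine ⟨fun h => h.2, fun h => ⟨?_, h⟩⟩
  simpa using (contDiffOn_zero (𝕜 := ℝ)).2 (h.continuousOn isOpen_Ioo)

lemma nConvexOn_succ {n : ℕ} (hn : 1 ≤ n) {a b : ℝ} {f : ℝ → ℝ} :
    NConvexOn (n + 1) a b f ↔
      DifferentiableOn ℝ f (Ioo a b) ∧ NConvexOn n a b (derivWithin f (Ioo a b)) := by
  obtain ⟨m, rfl⟩ := Nat.exists_eq_add_of_le' hn
  simp only [NConvexOn, Nat.add_sub_cancel, iteratedDerivWithin_succ']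
  have h := contDiffOn_succ_iff_derivWithin (𝕜 := ℝ) (f := f) (n := ((m : ℕ) : ℕ∞))
    (isOpen_Ioo (a := a) (b := b)).uniqueDiffOn
  push_cast at h ⊢
  rw [h]
  simp [and_assoc]

lemma NConvexOn.congr {n : ℕ} {a b : ℝ} {f g : ℝ → ℝ} (hf : NConvexOn n a b f)
    (h : EqOn f g (Ioo a b)) : NConvexOn n a b g :=
  ⟨hf.1.congr fun _ hx => (h hx).symm, hf.2.congr (iteratedDerivWithin_congr h)⟩

lemma NConvexOn.of_hasDerivAt {n : ℕ} (hn : 1 ≤ n) {a b : ℝ} {f f' : ℝ → ℝ}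
    (hf' : NConvexOn n a b f') (h : ∀ t ∈ Ioo a b, HasDerivAt f (f' t) t) :
    NConvexOn (n + 1) a b f := by
  refine (nConvexOn_succ hn).2
    ⟨fun t ht => (h t ht).differentiableAt.differentiableWithinAt, hf'.congr fun t ht => ?_⟩
  exact ((h t ht).hasDerivWithinAt.derivWithin (isOpen_Ioo.uniqueDiffWithinAt ht)).symm

lemma nConvexOn_const_mul_pow {n : ℕ} (hn : 1 ≤ n) (a b : ℝ) :
    ∀ {k : ℕ}, k ≤ n → ∀ c : ℝ, NConvexOn n a b fun t => c * t ^ k := by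
  induction n, hn using Nat.le_induction with
  | base =>
    intro k hk c
    rw [nConvexOn_one]
    refine ⟨convex_Ioo a b, fun _ _ _ _ u v _ _ huv => le_of_eq ?_⟩
    interval_cases k
    · simp [← add_mul, huv]
    · simp only [smul_eq_mul, pow_one]; ring
  | succ n hn ih =>
    intro k hk c
    refine NConvexOn.of_hasDerivAt hn (f' := fun t => (c * k) * t ^ (k - 1))
      (ih (by omega) _) fun t _ => ?_
    simpa [mul_assoc] using (hasDerivAt_pow k t).const_mul c

lemma nConvexOn_const_mul_max_pow {n : ℕ} (hn : 1 ≤ n) (a b x : ℝ) :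
    ∀ {c : ℝ}, 0 ≤ c → NConvexOn n a b fun t => c * max (t - x) 0 ^ n := by
  induction n, hn using Nat.le_induction with
  | base =>
    intro c hc
    rw [nConvexOn_one]
    have h : ConvexOn ℝ (Ioo a b) fun t : ℝ => max (t - x) 0 :=
      ((convexOn_id (convex_Ioo a b)).add_const (-x)).sup (convexOn_const 0 (convex_Ioo a b))
    simpa using h.smul hc
  | succ n hn ih =>
    intro c hc
    refine NConvexOn.of_hasDerivAt hn (f' := fun t => (c * (n + 1)) * max (t - x) 0 ^ n)
      (ih (by positivity)) fun t _ => ?_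
    simpa [mul_assoc] using (hasDerivAt_max_sub_zero_pow hn x t).const_mul c

/-! ### The cone generated by polynomials and truncated powers -/

/-- The convex cone generated by the polynomials of degree at most `n` and the truncated powers
`t ↦ (t - x)₊ⁿ` with `x ∈ (a, b)`. -/
inductive SplineCone (n : ℕ) (a b : ℝ) : (ℝ → ℝ) → Prop
  | pow (k : ℕ) (hk : k ≤ n) (c : ℝ) : SplineCone n a b fun t => c * t ^ k
  | trunc (c x : ℝ) (hc : 0 ≤ c) (hx : x ∈ Ioo a b) :
      SplineCone n a b fun t => c * max (t - x) 0 ^ n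
  | add (f g : ℝ → ℝ) (hf : SplineCone n a b f) (hg : SplineCone n a b g) :
      SplineCone n a b fun t => f t + g t

namespace SplineCone

variable {n : ℕ} {a b : ℝ} {f : ℝ → ℝ}

lemma continuous (hf : SplineCone n a b f) : Continuous f := by
  induction hf with
  | pow k hk c => fun_prop
  | trunc c x hc hx => fun_prop
  | add f g _ _ hf hg => exact hf.add hg

lemma const_mul (hf : SplineCone n a b f) {s : ℝ} (hs : 0 ≤ s) :
    SplineCone n a b fun t => s * f t := by
  induction hf with
  | pow k hk c => simpa [mul_assoc] using SplineCone.pow k hk (s * c)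
  | trunc c x hc hx => simpa [mul_assoc] using SplineCone.trunc (s * c) x (mul_nonneg hs hc) hx
  | add f g _ _ hf hg => simpa [mul_add] using SplineCone.add _ _ hf hg

lemma exists_hasDerivAt (hn : 1 ≤ n) (hf : SplineCone n a b f) :
    ∃ F, SplineCone (n + 1) a b F ∧ ∀ t, HasDerivAt F (f t) t := by
  induction hf with
  | pow k hk c =>
    refine ⟨_, .pow (k + 1) (by omega) (c / (k + 1)), fun t => ?_⟩
    refine ((hasDerivAt_pow (k + 1) t).const_mul (c / (k + 1))).congr_deriv ?_
    push_cast [Nat.add_sub_cancel]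
    field_simp
  | trunc c x hc hx =>
    refine ⟨_, .trunc (c / (n + 1)) x (by positivity) hx, fun t => ?_⟩
    refine ((hasDerivAt_max_sub_zero_pow hn x t).const_mul (c / (n + 1))).congr_deriv ?_
    field_simp
  | add f g _ _ hf hg =>
    obtain ⟨F, hF, hF'⟩ := hf
    obtain ⟨G, hG, hG'⟩ := hg
    exact ⟨_, .add _ _ hF hG, fun t => (hF' t).add (hG' t)⟩

lemma exists_hasDerivAt_eq (hn : 1 ≤ n) (hf : SplineCone n a b f) (x y : ℝ) :
    ∃ F, SplineCone (n + 1) a b F ∧ F x = y ∧ ∀ t, HasDerivAt F (f t) t := by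
  obtain ⟨F, hF, hF'⟩ := hf.exists_hasDerivAt hn
  refine ⟨_, hF.add _ _ (.pow 0 (Nat.zero_le _) (y - F x)), by simp, fun t => ?_⟩
  simpa using (hF' t).add_const (y - F x)

end SplineCone

lemma abs_sub_secant_le {g : ℝ → ℝ} {x h t ε : ℝ} (hh : 0 < h) (ht : x ≤ t) (ht' : t ≤ x + h)
    (h₀ : |g t - g x| ≤ ε) (h₁ : |g t - g (x + h)| ≤ ε) :
    |g t - (g x + (g (x + h) - g x) / h * (t - x))| ≤ ε := by
  set l := (t - x) / h with hl
  have hl0 : 0 ≤ l := div_nonneg (by linarith) hh.le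
  have hl1 : l ≤ 1 := (div_le_one hh).2 (by linarith)
  have e : g t - (g x + (g (x + h) - g x) / h * (t - x)) =
      (1 - l) * (g t - g x) + l * (g t - g (x + h)) := by
    rw [hl]; field_simp; ring
  rw [e]
  rw [abs_le] at *
  constructor <;> nlinarith

lemma exists_splineCone_one_approx {a b : ℝ} (hab : a < b) {g : ℝ → ℝ}
    (hg : ConvexOn ℝ (Icc a b) g) (hgc : ContinuousOn g (Icc a b)) {ε : ℝ} (hε : 0 < ε) :
    ∃ p, SplineCone 1 a b p ∧ ∀ t ∈ Icc a b, |g t - p t| ≤ ε := by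
  have huc := isCompact_Icc.uniformContinuousOn_of_continuous hgc
  obtain ⟨δ, hδ, huc⟩ := Metric.uniformContinuousOn_iff.1 huc ε hε
  obtain ⟨M, hM⟩ := exists_nat_gt ((b - a) / δ)
  have hM0 : (0 : ℝ) ≤ M := Nat.cast_nonneg M
  set h := (b - a) / (M + 1) with hh
  have hhpos : 0 < h := div_pos (by linarith) (by positivity)
  have hhδ : h < δ := by
    rw [div_lt_iff₀ hδ] at hM
    rw [hh, div_lt_iff₀ (by positivity)]
    nlinarith
  have hhM : (M + 1) * h = b - a := by rw [hh]; field_simp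
  have hnode : ∀ j : ℕ, j ≤ M + 1 → a + j * h ∈ Icc a b := fun j hj => by
    have hj' : (j : ℝ) ≤ M + 1 := by exact_mod_cast hj
    constructor
    · have : 0 ≤ j * h := by positivity
      linarith
    · nlinarith
  have hbound : ∀ j : ℕ, j ≤ M → ∀ t, a + j * h ≤ t → t ≤ a + j * h + h →
      |g t - (g (a + j * h) + (g (a + j * h + h) - g (a + j * h)) / h * (t - (a + j * h)))|
        ≤ ε := by
    intro j hj t h1 h2
    have m1 := hnode j (by omega)
    have m2 := hnode (j + 1) (by omega)
    have e2 : a + ((j + 1 : ℕ) : ℝ) * h = a + j * h + h := by push_cast; ring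
    rw [e2] at m2
    have mt : t ∈ Icc a b := ⟨m1.1.trans h1, h2.trans m2.2⟩
    refine abs_sub_secant_le hhpos h1 h2 ?_ ?_
    · refine (huc t mt _ m1 ?_).le
      rw [Real.dist_eq, abs_lt]; constructor <;> linarith
    · refine (huc t mt _ m2 ?_).le
      rw [Real.dist_eq, abs_lt]; constructor <;> linarith
  have key : ∀ j : ℕ, j ≤ M → ∃ p, SplineCone 1 a b p ∧
      (∀ t, a + j * h ≤ t →
        p t = g (a + j * h) + (g (a + j * h + h) - g (a + j * h)) / h * (t - (a + j * h))) ∧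
      ∀ t ∈ Icc a (a + j * h + h), |g t - p t| ≤ ε := by
    intro j
    induction j with
    | zero =>
      intro _
      set s := (g (a + h) - g a) / h with hs
      have hp : SplineCone 1 a b fun t => (g a - s * a) * t ^ 0 + s * t ^ 1 :=
        .add _ _ (.pow 0 (by omega) _) (.pow 1 le_rfl s)
      refine ⟨_, hp, fun t _ => ?_, fun t ht => ?_⟩
      · simp only [Nat.cast_zero, zero_mul, add_zero, ← hs]; ring
      · have hb := hbound 0 (Nat.zero_le _) t (by simpa using ht.1) (by simpa using ht.2)
        simp only [Nat.cast_zero, zero_mul, add_zero, ← hs] at hb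
        convert hb using 3
        ring
    | succ j ih =>
      intro hj
      obtain ⟨p, hp, hpf, hpε⟩ := ih (by omega)
      have e1 : a + ((j + 1 : ℕ) : ℝ) * h = a + j * h + h := by push_cast; ring
      have m0 := hnode j (by omega)
      have m1 := hnode (j + 1) (by omega)
      have m2 := hnode (j + 1 + 1) (by omega)
      have e2 : a + ((j + 1 + 1 : ℕ) : ℝ) * h = a + j * h + h + h := by push_cast; ring
      have hb := hbound (j + 1) hj
      rw [e2] at m2
      rw [e1] at m1 hb ⊢
      set x := a + j * h
      set s₀ := (g (x + h) - g x) / h with hs₀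
      set s₁ := (g (x + h + h) - g (x + h)) / h with hs₁
      have hs : s₀ ≤ s₁ := by
        have := hg.slope_mono_adjacent m0 m2 (show x < x + h by linarith)
          (show x + h < x + h + h by linarith)
        simpa [hs₀, hs₁] using this
      have hx : x + h ∈ Ioo a b := ⟨by linarith [m0.1], by linarith [m2.2]⟩
      have hs₀h : s₀ * h = g (x + h) - g x := by rw [hs₀]; field_simp
      have hformula : ∀ t, x + h ≤ t →
          p t + (s₁ - s₀) * max (t - (x + h)) 0 ^ 1 = g (x + h) + s₁ * (t - (x + h)) := by
        intro t ht
        rw [hpf t (by linarith), max_eq_left (by linarith)]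
        linear_combination hs₀h
      refine ⟨_, hp.add _ _ (.trunc (s₁ - s₀) (x + h) (by linarith) hx), hformula, fun t ht => ?_⟩
      rcases le_total t (x + h) with h1 | h1
      · rw [max_eq_right (by linarith)]
        simpa using hpε t ⟨ht.1, h1⟩
      · rw [hformula t h1]
        exact hb t h1 ht.2
  obtain ⟨p, hp, -, hpε⟩ := key M le_rfl
  refine ⟨p, hp, fun t ht => hpε t ⟨ht.1, ?_⟩⟩
  linarith [ht.2]

/-- An `n`-convex function on an open interval, precomposed with an increasing affine map of
`[a, b]` into that interval, is a uniform limit of elements of the spline cone. -/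
lemma exists_splineCone_approx_comp_affine {a b c d m s : ℝ} (hab : a < b) (hs : 0 < s)
    (hφ : ∀ t ∈ Icc a b, m + s * t ∈ Ioo c d) {n : ℕ} (hn : 1 ≤ n) :
    ∀ {f : ℝ → ℝ}, NConvexOn n c d f → ∀ {ε : ℝ}, 0 < ε →
      ∃ p, SplineCone n a b p ∧ ∀ t ∈ Icc a b, |f (m + s * t) - p t| ≤ ε := by
  induction n, hn using Nat.le_induction with
  | base =>
    intro f hf ε hε
    rw [nConvexOn_one] at hf
    refine exists_splineCone_one_approx hab (g := fun t => f (m + s * t))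
      ⟨convex_Icc a b, fun x hx y hy u v hu hv huv => ?_⟩ ?_ hε
    · have := hf.2 (hφ x hx) (hφ y hy) hu hv huv
      convert this using 2
      simp only [smul_eq_mul]
      linear_combination -m * huv
    · exact (hf.continuousOn isOpen_Ioo).comp (by fun_prop) hφ
  | succ n hn ih =>
    intro f hf ε hε
    obtain ⟨hfd, hf'⟩ := (nConvexOn_succ hn).1 hf
    have hba : 0 < b - a := by linarith
    obtain ⟨q, hq, hqε⟩ := ih hf' (ε := ε / (b - a) / s) (by positivity)
    obtain ⟨p, hp, hpa, hp'⟩ := (hq.const_mul hs.le).exists_hasDerivAt_eq hn a (f (m + s * a))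
    refine ⟨p, hp, fun t ht => ?_⟩
    have hder : ∀ u ∈ Icc a b, HasDerivWithinAt (fun u => f (m + s * u) - p u)
        (derivWithin f (Ioo c d) (m + s * u) * s - s * q u) (Icc a b) u := fun u hu => by
      have h1 : HasDerivAt f (derivWithin f (Ioo c d) (m + s * u)) (m + s * u) :=
        (hfd _ (hφ u hu)).hasDerivWithinAt.hasDerivAt (isOpen_Ioo.mem_nhds (hφ u hu))
      have h2 : HasDerivAt (fun u : ℝ => m + s * u) s u := by
        simpa using ((hasDerivAt_id u).const_mul s).const_add m
      exact ((h1.comp u h2).sub (hp' u)).hasDerivWithinAt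
    have hle := norm_image_sub_le_of_norm_deriv_le_segment' (C := ε / (b - a)) hder
      (fun u hu => ?_) t ht
    · simp only [hpa, sub_self, sub_zero, Real.norm_eq_abs] at hle
      refine hle.trans ?_
      rw [div_mul_eq_mul_div, div_le_iff₀ hba]
      exact mul_le_mul_of_nonneg_left (by linarith [ht.2]) hε.le
    · have h3 := hqε u (Ico_subset_Icc_self hu)
      rw [le_div_iff₀ hs] at h3
      rw [mul_comm _ s, ← mul_sub, norm_mul, Real.norm_of_nonneg hs.le, mul_comm]
      exact h3

lemma NConvexOn.exists_splineCone_approx {a b : ℝ} (hab : a < b) {n : ℕ} (hn : 1 ≤ n)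
    {f : ℝ → ℝ} (hf : NConvexOn n a b f) (hfc : ContinuousOn f (Icc a b)) {ε : ℝ} (hε : 0 < ε) :
    ∃ p, SplineCone n a b p ∧ ∀ t ∈ Icc a b, |f t - p t| ≤ ε := by
  have huc := isCompact_Icc.uniformContinuousOn_of_continuous hfc
  obtain ⟨δ, hδ, huc⟩ := Metric.uniformContinuousOn_iff.1 huc (ε / 2) (by positivity)
  have hba : 0 < b - a := by linarith
  obtain ⟨r, hr0, hr⟩ := exists_between (show 0 < min 1 (δ / (b - a)) by positivity)
  have hr1 : r < 1 := hr.trans_le (min_le_left _ _)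
  have hrδ : r * (b - a) < δ := (lt_div_iff₀ hba).1 (hr.trans_le (min_le_right _ _))
  have hφ : ∀ t ∈ Icc a b, r * ((a + b) / 2) + (1 - r) * t ∈ Ioo a b := fun t ht => by
    constructor <;> nlinarith [ht.1, ht.2]
  obtain ⟨p, hp, hpε⟩ := exists_splineCone_approx_comp_affine hab (sub_pos.2 hr1) hφ hn hf
    (half_pos hε)
  refine ⟨p, hp, fun t ht => ?_⟩
  have h1 := hpε t ht
  have h2 := huc t ht _ (Ioo_subset_Icc_self (hφ t ht)) (by
    rw [Real.dist_eq, abs_lt]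
    constructor <;> nlinarith [ht.1, ht.2])
  rw [Real.dist_eq] at h2
  calc |f t - p t| ≤ |f t - f (r * ((a + b) / 2) + (1 - r) * t)| +
        |f (r * ((a + b) / 2) + (1 - r) * t) - p t| := abs_sub_le _ _ _
    _ ≤ ε := by linarith

/-! ### Integration against signed measures -/

lemma sintegral_const_mul (μ : SignedMeasure ℝ) (c : ℝ) (f : ℝ → ℝ) :
    sintegral μ (fun x => c * f x) = c * sintegral μ f := by
  simp only [sintegral, integral_const_mul]; ring

namespace ConcentratedOn

variable {μ : SignedMeasure ℝ} {a b : ℝ} {f g : ℝ → ℝ}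

lemma ae_mem_Icc (hμ : ConcentratedOn μ (Ioo a b)) :
    (∀ᵐ x ∂μ.toJordanDecomposition.posPart, x ∈ Icc a b) ∧
      ∀ᵐ x ∂μ.toJordanDecomposition.negPart, x ∈ Icc a b := by
  have h : ∀ᵐ x ∂μ.totalVariation, x ∈ Icc a b :=
    measure_mono_null (compl_subset_compl.2 Ioo_subset_Icc_self) hμ
  rwa [SignedMeasure.totalVariation, ae_add_measure_iff] at h

lemma restrict_Icc (hμ : ConcentratedOn μ (Ioo a b)) :
    μ.toJordanDecomposition.posPart.restrict (Icc a b) = μ.toJordanDecomposition.posPart ∧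
      μ.toJordanDecomposition.negPart.restrict (Icc a b) = μ.toJordanDecomposition.negPart :=
  ⟨Measure.restrict_eq_self_of_ae_mem hμ.ae_mem_Icc.1,
    Measure.restrict_eq_self_of_ae_mem hμ.ae_mem_Icc.2⟩

lemma sintegralOn_Icc (hμ : ConcentratedOn μ (Ioo a b)) (f : ℝ → ℝ) :
    sintegralOn μ (Icc a b) f = sintegral μ f := by
  rw [sintegralOn, hμ.restrict_Icc.1, hμ.restrict_Icc.2, sintegral]

lemma sintegral_one (hμ : ConcentratedOn μ (Ioo a b)) :
    sintegral μ (fun _ => 1) = μ (Ioo a b) := by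
  have h : μ.toJordanDecomposition.posPart (Ioo a b)ᶜ = 0 ∧
      μ.toJordanDecomposition.negPart (Ioo a b)ᶜ = 0 := by
    have h := hμ
    rwa [ConcentratedOn, SignedMeasure.totalVariation, Measure.add_apply, add_eq_zero] at h
  conv_rhs => rw [← μ.toSignedMeasure_toJordanDecomposition]
  rw [JordanDecomposition.toSignedMeasure, Measure.toSignedMeasure_sub_apply measurableSet_Ioo]
  simp only [sintegral, integral_const, smul_eq_mul, mul_one, measureReal_def]
  rw [← measure_add_measure_compl (measurableSet_Ioo (a := a) (b := b)), h.1, add_zero,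
    ← measure_add_measure_compl (μ := μ.toJordanDecomposition.negPart)
      (measurableSet_Ioo (a := a) (b := b)), h.2, add_zero]

lemma integrable (hμ : ConcentratedOn μ (Ioo a b)) (hf : ContinuousOn f (Icc a b)) :
    Integrable f μ.toJordanDecomposition.posPart ∧
      Integrable f μ.toJordanDecomposition.negPart := by
  have h1 : IntegrableOn f (Icc a b) μ.toJordanDecomposition.posPart :=
    hf.integrableOn_compact isCompact_Icc
  have h2 : IntegrableOn f (Icc a b) μ.toJordanDecomposition.negPart :=
    hf.integrableOn_compact isCompact_Icc
  rw [IntegrableOn, hμ.restrict_Icc.1] at h1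
  rw [IntegrableOn, hμ.restrict_Icc.2] at h2
  exact ⟨h1, h2⟩

lemma sintegral_add (hμ : ConcentratedOn μ (Ioo a b)) (hf : ContinuousOn f (Icc a b))
    (hg : ContinuousOn g (Icc a b)) :
    sintegral μ (fun x => f x + g x) = sintegral μ f + sintegral μ g := by
  simp only [sintegral, integral_add (hμ.integrable hf).1 (hμ.integrable hg).1,
    integral_add (hμ.integrable hf).2 (hμ.integrable hg).2]
  ring

lemma abs_sintegral_sub_le (hμ : ConcentratedOn μ (Ioo a b)) (hf : ContinuousOn f (Icc a b))
    (hg : ContinuousOn g (Icc a b)) {ε : ℝ} (h : ∀ t ∈ Icc a b, |f t - g t| ≤ ε) :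
    |sintegral μ f - sintegral μ g| ≤ ε * μ.totalVariation.real univ := by
  have h1 := norm_integral_le_of_norm_le_const (f := fun t => f t - g t)
    (hμ.ae_mem_Icc.1.mono fun t ht => h t ht)
  have h2 := norm_integral_le_of_norm_le_const (f := fun t => f t - g t)
    (hμ.ae_mem_Icc.2.mono fun t ht => h t ht)
  rw [integral_sub (hμ.integrable hf).1 (hμ.integrable hg).1] at h1
  rw [integral_sub (hμ.integrable hf).2 (hμ.integrable hg).2] at h2
  rw [SignedMeasure.totalVariation, measureReal_add_apply, mul_add]
  simp only [sintegral]
  rw [Real.norm_eq_abs, abs_le] at *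
  constructor <;> linarith [h1.1, h1.2, h2.1, h2.2]

end ConcentratedOn

lemma SplineCone.sintegral_le {n : ℕ} {a b : ℝ} {μ₁ μ₂ : SignedMeasure ℝ}
    (hμ₁ : ConcentratedOn μ₁ (Ioo a b)) (hμ₂ : ConcentratedOn μ₂ (Ioo a b))
    (hpow : ∀ k ≤ n, sintegral μ₁ (fun x => x ^ k) = sintegral μ₂ (fun x => x ^ k))
    (htrunc : ∀ x ∈ Ioo a b, sintegral μ₁ (fun t => max (t - x) 0 ^ n) ≤
      sintegral μ₂ (fun t => max (t - x) 0 ^ n))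
    {p : ℝ → ℝ} (hp : SplineCone n a b p) : sintegral μ₁ p ≤ sintegral μ₂ p := by
  induction hp with
  | pow k hk c => rw [sintegral_const_mul, sintegral_const_mul, hpow k hk]
  | trunc c x hc hx =>
    rw [sintegral_const_mul, sintegral_const_mul]
    exact mul_le_mul_of_nonneg_left (htrunc x hx) hc
  | add f g hf hg ihf ihg =>
    rw [hμ₁.sintegral_add hf.continuous.continuousOn hg.continuous.continuousOn,
      hμ₂.sintegral_add hf.continuous.continuousOn hg.continuous.continuousOn]
    exact add_le_add ihf ihg

/-- **Corollary 2.4.** For signed measures `μ₁, μ₂` concentrated on `(a,b)` with finite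
`n`-th absolute moments, `∫ f dμ₁ ≤ ∫ f dμ₂` for all continuous `n`-convex `f : [a,b] → ℝ`
iff the total masses agree, the moments up to order `n` agree, and
`∫ (t−x)₊ⁿ dμ₁(t) ≤ ∫ (t−x)₊ⁿ dμ₂(t)` for all `x ∈ (a,b)`. -/
theorem statement6 (a b : ℝ) (hab : a < b) (n : ℕ) (hn : 1 ≤ n)
    (μ₁ μ₂ : SignedMeasure ℝ)
    (hμ₁ : ConcentratedOn μ₁ (Ioo a b)) (hμ₂ : ConcentratedOn μ₂ (Ioo a b))
    (hmom₁ : Integrable (fun x => |x| ^ n) μ₁.totalVariation)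
    (hmom₂ : Integrable (fun x => |x| ^ n) μ₂.totalVariation) :
    (∀ f : ℝ → ℝ, ContinuousOn f (Icc a b) → NConvexOn n a b f →
        sintegralOn μ₁ (Icc a b) f ≤ sintegralOn μ₂ (Icc a b) f) ↔
      (μ₁ (Ioo a b) = μ₂ (Ioo a b) ∧
        (∀ k, 1 ≤ k → k ≤ n →
          sintegral μ₁ (fun x => x ^ k) = sintegral μ₂ (fun x => x ^ k)) ∧
        (∀ x ∈ Ioo a b,
          sintegral μ₁ (fun t => (max (t - x) 0) ^ n) ≤
            sintegral μ₂ (fun t => (max (t - x) 0) ^ n))) := by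
  simp only [hμ₁.sintegralOn_Icc, hμ₂.sintegralOn_Icc]
  constructor
  · intro H
    have hpow : ∀ k ≤ n, sintegral μ₁ (fun x => x ^ k) = sintegral μ₂ (fun x => x ^ k) := by
      intro k hk
      have h1 := H _ (by fun_prop) (nConvexOn_const_mul_pow hn a b hk 1)
      have h2 := H _ (by fun_prop) (nConvexOn_const_mul_pow hn a b hk (-1))
      rw [sintegral_const_mul, sintegral_const_mul] at h1 h2
      linarith
    refine ⟨?_, fun k _ hk => hpow k hk, fun x _ => ?_⟩
    · have h0 := hpow 0 (Nat.zero_le n)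
      simp only [pow_zero] at h0
      rwa [hμ₁.sintegral_one, hμ₂.sintegral_one] at h0
    · simpa using H _ (by fun_prop) (nConvexOn_const_mul_max_pow hn a b x zero_le_one)
  · rintro ⟨hmass, hmom, htrunc⟩ f hfc hf
    have hpow : ∀ k ≤ n, sintegral μ₁ (fun x => x ^ k) = sintegral μ₂ (fun x => x ^ k) := by
      intro k hk
      rcases Nat.eq_zero_or_pos k with rfl | hk0
      · simpa only [pow_zero, hμ₁.sintegral_one, hμ₂.sintegral_one] using hmass
      · exact hmom k hk0 hk
    set C := μ₁.totalVariation.real univ + μ₂.totalVariation.real univ + 1 with hC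
    have hCpos : 0 < C := by positivity
    refine le_of_forall_pos_le_add fun ε hε => ?_
    obtain ⟨p, hp, hpε⟩ := hf.exists_splineCone_approx hab hn hfc (div_pos hε hCpos)
    have h1 := abs_le.1 (hμ₁.abs_sintegral_sub_le hfc hp.continuous.continuousOn hpε)
    have h2 := abs_le.1 (hμ₂.abs_sintegral_sub_le hfc hp.continuous.continuousOn hpε)
    have h3 := hp.sintegral_le hμ₁ hμ₂ hpow htrunc
    have h4 : ε / C * C = ε := div_mul_cancel₀ _ hCpos.ne'
    rw [hC, mul_add, mul_add, ← hC] at h4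
    have h5 : 0 < ε / C := div_pos hε hCpos
    linarith [h1.2, h2.1]
end

section
/- Let a < b be real numbers and n ≥ 1 a natural number. Let μ be a finite signed measure on ℝ concentrated on (a,b] with distribution function F(x) = μ((a,x]) (so F(a) = 0), and define I₀ = F and I_k(x) = ∫_a^x I_{k−1}(t) dt for k ≥ 1. Then for every x ∈ [a,b], I_n(x) = ∫_{(a,x]} (x − t)ⁿ / n! dμ(t). -/
open MeasureTheory Set

/-- The kernel `(s - t)ⁿ / n!`, cut off to `t ≤ s`, is integrable on a bounded square. -/
lemma integrable_truncatedPower (ν : Measure ℝ) [IsFiniteMeasure ν] (a x : ℝ) (n : ℕ) :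
    Integrable
      (fun p : ℝ × ℝ => {p : ℝ × ℝ | p.2 ≤ p.1}.indicator
        (fun p => (p.1 - p.2) ^ n / (n.factorial : ℝ)) p)
      ((volume.restrict (Ioc a x)).prod (ν.restrict (Ioc a x))) := by
  have hmeas : MeasurableSet {p : ℝ × ℝ | p.2 ≤ p.1} :=
    measurableSet_le measurable_snd measurable_fst
  refine Integrable.of_bound (C := (x - a) ^ n / (n.factorial : ℝ)) ?_ ?_
  · exact (Measurable.indicator (by fun_prop) hmeas).aestronglyMeasurable
  · rw [Measure.prod_restrict]
    filter_upwards [ae_restrict_mem (measurableSet_Ioc.prod measurableSet_Ioc)] with p hp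
    obtain ⟨⟨h1, h2⟩, h3, h4⟩ := hp
    by_cases h : p.2 ≤ p.1
    · rw [indicator_of_mem (show p ∈ {p : ℝ × ℝ | p.2 ≤ p.1} from h), Real.norm_of_nonneg]
      · gcongr
      · have := sub_nonneg.2 h
        positivity
    · rw [indicator_of_notMem (show p ∉ {p : ℝ × ℝ | p.2 ≤ p.1} from h), norm_zero]
      have : 0 ≤ x - a := by linarith
      positivity

lemma setIntegral_truncatedPower (ν : Measure ℝ) {a x s : ℝ} (hs : s ≤ x) (n : ℕ) :
    ∫ t in Ioc a x, {p : ℝ × ℝ | p.2 ≤ p.1}.indicator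
        (fun p => (p.1 - p.2) ^ n / (n.factorial : ℝ)) (s, t) ∂ν =
      ∫ t in Ioc a s, (s - t) ^ n / (n.factorial : ℝ) ∂ν := by
  have h : (fun t => {p : ℝ × ℝ | p.2 ≤ p.1}.indicator
      (fun p => (p.1 - p.2) ^ n / (n.factorial : ℝ)) (s, t)) =
      (Iic s).indicator (fun t => (s - t) ^ n / (n.factorial : ℝ)) := by
    ext t
    simp [indicator_apply]
  rw [h, setIntegral_indicator measurableSet_Iic, Ioc_inter_Iic, inf_eq_right.2 hs]

lemma intervalIntegrable_setIntegral_pow (ν : Measure ℝ) [IsFiniteMeasure ν] {a x : ℝ}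
    (hx : a ≤ x) (n : ℕ) :
    IntervalIntegrable (fun s => ∫ t in Ioc a s, (s - t) ^ n / (n.factorial : ℝ) ∂ν)
      volume a x := by
  rw [intervalIntegrable_iff_integrableOn_Ioc_of_le hx]
  refine (integrable_truncatedPower ν a x n).integral_prod_left.congr ?_
  filter_upwards [ae_restrict_mem measurableSet_Ioc] with s hs
  exact setIntegral_truncatedPower ν hs.2 n

lemma integral_sub_pow_div_factorial (t x : ℝ) (n : ℕ) :
    ∫ s in t..x, (s - t) ^ n / (n.factorial : ℝ) =
      (x - t) ^ (n + 1) / ((n + 1).factorial : ℝ) := by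
  rw [intervalIntegral.integral_div,
    intervalIntegral.integral_comp_sub_right (fun s => s ^ n) t, integral_pow,
    Nat.factorial_succ]
  have := n.factorial_ne_zero
  push_cast
  field_simp
  simp

lemma intervalIntegral_setIntegral_pow (ν : Measure ℝ) [IsFiniteMeasure ν] {a x : ℝ}
    (hx : a ≤ x) (n : ℕ) :
    ∫ s in a..x, ∫ t in Ioc a s, (s - t) ^ n / (n.factorial : ℝ) ∂ν =
      ∫ t in Ioc a x, (x - t) ^ (n + 1) / ((n + 1).factorial : ℝ) ∂ν := by
  have hswap := integral_integral_swap (f := fun s t => {p : ℝ × ℝ | p.2 ≤ p.1}.indicator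
    (fun p => (p.1 - p.2) ^ n / (n.factorial : ℝ)) (s, t)) (integrable_truncatedPower ν a x n)
  rw [intervalIntegral.integral_of_le hx,
    ← setIntegral_congr_fun measurableSet_Ioc
      (fun s hs => setIntegral_truncatedPower ν (a := a) hs.2 n)]
  refine hswap.trans (setIntegral_congr_fun measurableSet_Ioc fun t ht => ?_)
  have h : (fun s => {p : ℝ × ℝ | p.2 ≤ p.1}.indicator
      (fun p => (p.1 - p.2) ^ n / (n.factorial : ℝ)) (s, t)) =
      (Ici t).indicator (fun s => (s - t) ^ n / (n.factorial : ℝ)) := by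
    ext s
    simp [indicator_apply]
  have hset : Ioc a x ∩ Ici t = Icc t x := by
    ext s
    simp only [mem_inter_iff, mem_Ioc, mem_Ici, mem_Icc]
    exact ⟨fun h => ⟨h.2, h.1.2⟩, fun h => ⟨⟨ht.1.trans_le h.1, h.2⟩, h.1⟩⟩
  simp only [h]
  rw [setIntegral_indicator measurableSet_Ici, hset, integral_Icc_eq_integral_Ioc,
    ← intervalIntegral.integral_of_le ht.2, integral_sub_pow_div_factorial]

lemma iterInt_distribution_eq (μ : SignedMeasure ℝ) (a : ℝ) {F : ℝ → ℝ}
    (hF : ∀ x, F x = μ (Ioc a x)) (n : ℕ) :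
    ∀ x, a ≤ x → iterInt a F n x =
      sintegralOn μ (Ioc a x) (fun t => (x - t) ^ n / (n.factorial : ℝ)) := by
  induction n with
  | zero =>
    intro x _
    simp [iterInt, sintegralOn, hF,
      μ.apply_eq_posPart_real_sub_negPart_real measurableSet_Ioc]
  | succ n ih =>
    intro x hx
    have hcongr : iterInt a F (n + 1) x = ∫ s in a..x,
        sintegralOn μ (Ioc a s) (fun t => (s - t) ^ n / (n.factorial : ℝ)) := by
      refine intervalIntegral.integral_congr fun s hs => ih s ?_
      rw [uIcc_of_le hx] at hs
      exact hs.1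
    simp only [hcongr, sintegralOn]
    rw [intervalIntegral.integral_sub (intervalIntegrable_setIntegral_pow _ hx n)
        (intervalIntegrable_setIntegral_pow _ hx n),
      intervalIntegral_setIntegral_pow _ hx, intervalIntegral_setIntegral_pow _ hx]

/-- **Iterated-integral representation.** For `μ` concentrated on `(a,b]` with
distribution function `F`, the `n`-th iterated integral satisfies
`I_n(x) = ∫_{(a,x]} (x − t)ⁿ / n! dμ(t)` for every `x ∈ [a,b]`. -/
theorem statement7 (a b : ℝ) (hab : a < b) (n : ℕ) (hn : 1 ≤ n)
    (μ : SignedMeasure ℝ) (hμ : ConcentratedOn μ (Ioc a b))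
    (F : ℝ → ℝ) (hF : ∀ x, F x = μ (Ioc a x)) :
    ∀ x ∈ Icc a b,
      iterInt a F n x =
        sintegralOn μ (Ioc a x) (fun t => (x - t) ^ n / (n.factorial : ℝ)) := by
  exact fun x hx => iterInt_distribution_eq μ a hF n x hx.1
end

section
/- Let a < b be real numbers and n ≥ 1 a natural number. Let μ₁, μ₂ be finite signed measures on ℝ concentrated on (a,b], with distribution functions F₁(x) = μ₁((a,x]), F₂(x) = μ₂((a,x]). Define H₀ = F₂ − F₁ and H_k(x) = ∫_a^x H_{k−1}(t) dt for k = 1, …, n. If μ₁((a,b]) = μ₂((a,b]) and ∫ t^k dμ₁(t) = ∫ t^k dμ₂(t) for all k = 1, …, n, then for every x ∈ [a,b], H_n(x) = (−1)^{n+1} ∫_{(a,b]} (t − x)₊ⁿ / n! d(μ₂ − μ₁)(t), where y₊ⁿ = (max{y, 0})ⁿ. -/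
open MeasureTheory Set

/-- The kernel `(x - t)ⁿ / n!` truncated to `t ≤ x`; for `n = 0` it is the indicator of `t ≤ x`. -/
noncomputable def truncKernel (n : ℕ) (x t : ℝ) : ℝ :=
  if t ≤ x then (x - t) ^ n / (n.factorial : ℝ) else 0

lemma measurable_truncKernel (n : ℕ) :
    Measurable (fun p : ℝ × ℝ => truncKernel n p.1 p.2) := by
  unfold truncKernel
  exact Measurable.ite (measurableSet_le measurable_snd measurable_fst)
    (by fun_prop) measurable_const

lemma norm_truncKernel_le (n : ℕ) {a b x t : ℝ} (hx : x ≤ b) (ht : a < t) (hab : a ≤ b) :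
    ‖truncKernel n x t‖ ≤ (b - a) ^ n / (n.factorial : ℝ) := by
  have hba : 0 ≤ b - a := sub_nonneg.2 hab
  unfold truncKernel
  split_ifs with h
  · have hxt : 0 ≤ x - t := sub_nonneg.2 h
    rw [Real.norm_of_nonneg (by positivity)]
    gcongr
  · rw [norm_zero]
    positivity

lemma integral_truncKernel (n : ℕ) {a x t : ℝ} (ht : a < t) :
    ∫ s in a..x, truncKernel n s t = truncKernel (n + 1) x t := by
  have hzero : ∀ y ≤ t, ∫ s in a..y, truncKernel n s t = 0 := by
    intro y hy
    apply intervalIntegral.integral_zero_ae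
    filter_upwards [compl_mem_ae_iff.2 (measure_singleton t)] with s hs hmem
    have hst : s < t := by
      refine lt_of_le_of_ne ?_ hs
      rcases Set.mem_uIoc.1 hmem with h | h
      · exact h.2.trans hy
      · exact h.2.trans ht.le
    exact if_neg hst.not_ge
  rcases le_or_gt t x with htx | htx
  · have heq : EqOn (fun s => truncKernel n s t) (fun s => (s - t) ^ n / (n.factorial : ℝ))
        (uIcc t x) := by
      intro s hs
      rw [uIcc_of_le htx] at hs
      exact if_pos hs.1
    have hint : IntervalIntegrable (fun s => truncKernel n s t) volume t x :=
      IntervalIntegrable.congr (heq.symm.mono uIoc_subset_uIcc)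
        ((by fun_prop : Continuous _).intervalIntegrable _ _)
    have hint' : IntervalIntegrable (fun s => truncKernel n s t) volume a t := by
      rw [intervalIntegrable_iff_integrableOn_Ioc_of_le ht.le]
      refine Integrable.of_bound (C := (t - a) ^ n / (n.factorial : ℝ)) ?_ ?_
      · exact ((measurable_truncKernel n).comp
          (measurable_id.prodMk measurable_const)).aestronglyMeasurable
      · exact ae_restrict_of_forall_mem measurableSet_Ioc
          fun s hs => norm_truncKernel_le n hs.2 ht ht.le
    rw [← intervalIntegral.integral_add_adjacent_intervals hint' hint, hzero t le_rfl, zero_add,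
      intervalIntegral.integral_congr heq, intervalIntegral.integral_div,
      intervalIntegral.integral_comp_sub_right (fun s => s ^ n), integral_pow, truncKernel,
      if_pos htx, Nat.factorial_succ]
    push_cast
    field_simp
    simp
  · rw [hzero x htx.le, truncKernel, if_neg htx.not_ge]

lemma integrable_truncKernel_prod (n : ℕ) {a b x : ℝ} (hx : x ∈ Icc a b) (P : Measure ℝ)
    [IsFiniteMeasure P] :
    Integrable (Function.uncurry (truncKernel n))
      ((volume.restrict (Ioc a x)).prod (P.restrict (Ioc a b))) := by
  refine Integrable.of_bound (C := (b - a) ^ n / (n.factorial : ℝ))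
    (measurable_truncKernel n).aestronglyMeasurable ?_
  rw [Measure.prod_restrict]
  exact ae_restrict_of_forall_mem (measurableSet_Ioc.prod measurableSet_Ioc)
    fun p hp => norm_truncKernel_le n (hp.1.2.trans hx.2) hp.2.1 (hx.1.trans hx.2)

lemma intervalIntegrable_integral_truncKernel (n : ℕ) {a b x : ℝ} (hx : x ∈ Icc a b)
    (P : Measure ℝ) [IsFiniteMeasure P] :
    IntervalIntegrable (fun s => ∫ t in Ioc a b, truncKernel n s t ∂P) volume a x := by
  rw [intervalIntegrable_iff_integrableOn_Ioc_of_le hx.1]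
  exact (integrable_truncKernel_prod n hx P).integral_prod_left

lemma integral_integral_truncKernel (n : ℕ) {a b x : ℝ} (hx : x ∈ Icc a b)
    (P : Measure ℝ) [IsFiniteMeasure P] :
    ∫ s in a..x, ∫ t in Ioc a b, truncKernel n s t ∂P =
      ∫ t in Ioc a b, truncKernel (n + 1) x t ∂P := by
  rw [intervalIntegral.integral_of_le hx.1,
    integral_integral_swap (integrable_truncKernel_prod n hx P)]
  refine setIntegral_congr_fun measurableSet_Ioc fun t ht => ?_
  simp only [← intervalIntegral.integral_of_le hx.1]
  exact integral_truncKernel n ht.1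

lemma integral_truncKernel_zero {a b x : ℝ} (hx : x ∈ Icc a b) (P : Measure ℝ) :
    ∫ t in Ioc a b, truncKernel 0 x t ∂P = P.real (Ioc a x) := by
  have : truncKernel 0 x = (Iic x).indicator 1 := by
    ext t
    simp [truncKernel, indicator]
  rw [this, integral_indicator_one measurableSet_Iic, measureReal_restrict_apply measurableSet_Iic]
  congr 1
  ext t
  simp only [mem_inter_iff, mem_Iic, mem_Ioc]
  constructor
  · exact fun h => ⟨h.2.1, h.1⟩
  · exact fun h => ⟨h.2, h.1, h.2.trans hx.2⟩

lemma iterInt_eq_integral_truncKernel {a b : ℝ} (P N : Measure ℝ) [IsFiniteMeasure P]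
    [IsFiniteMeasure N] (F : ℝ → ℝ) (hF : ∀ x, F x = P.real (Ioc a x) - N.real (Ioc a x))
    (n : ℕ) : ∀ x ∈ Icc a b, iterInt a F n x =
      (∫ t in Ioc a b, truncKernel n x t ∂P) - ∫ t in Ioc a b, truncKernel n x t ∂N := by
  induction n with
  | zero =>
    intro x hx
    rw [integral_truncKernel_zero hx, integral_truncKernel_zero hx]
    exact hF x
  | succ n ih =>
    intro x hx
    rw [← integral_integral_truncKernel n hx, ← integral_integral_truncKernel n hx,
      ← intervalIntegral.integral_sub (intervalIntegrable_integral_truncKernel n hx P)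
        (intervalIntegrable_integral_truncKernel n hx N)]
    refine intervalIntegral.integral_congr fun s hs => ?_
    rw [uIcc_of_le hx.1] at hs
    exact ih s ⟨hs.1, hs.2.trans hx.2⟩

lemma truncKernel_eq {n : ℕ} (hn : n ≠ 0) (x t : ℝ) :
    truncKernel n x t = (x - t) ^ n / (n.factorial : ℝ) +
      (-1) ^ (n + 1) * ((max (t - x) 0) ^ n / (n.factorial : ℝ)) := by
  unfold truncKernel
  split_ifs with h
  · simp [max_eq_right (sub_nonpos.2 h), hn]
  · rw [max_eq_left (by linarith), ← neg_sub t x, neg_pow, pow_succ]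
    ring

lemma integral_sub_pow_eq {P N : Measure ℝ} {n : ℕ}
    (hP : ∀ k, Integrable (fun t : ℝ => t ^ k) P) (hN : ∀ k, Integrable (fun t : ℝ => t ^ k) N)
    (h : ∀ k ≤ n, ∫ t, t ^ k ∂P = ∫ t, t ^ k ∂N) (x : ℝ) :
    ∫ t, (x - t) ^ n ∂P = ∫ t, (x - t) ^ n ∂N := by
  have hexp : ∀ t : ℝ, (x - t) ^ n =
      ∑ k ∈ Finset.range (n + 1), t ^ k * ((-1) ^ k * x ^ (n - k) * n.choose k) := by
    intro t
    rw [sub_eq_neg_add, add_pow]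
    refine Finset.sum_congr rfl fun k _ => ?_
    rw [neg_pow]
    ring
  simp only [hexp]
  rw [integral_finsetSum _ fun k _ => (hP k).mul_const _,
    integral_finsetSum _ fun k _ => (hN k).mul_const _]
  refine Finset.sum_congr rfl fun k hk => ?_
  rw [integral_mul_const, integral_mul_const, h k (Finset.mem_range_succ_iff.1 hk)]

lemma integrable_restrict_Ioc {f : ℝ → ℝ} (hf : Continuous f) (a b : ℝ) (P : Measure ℝ)
    [IsFiniteMeasure P] : Integrable f (P.restrict (Ioc a b)) :=
  (hf.continuousOn.integrableOn_compact isCompact_Icc).mono_set Ioc_subset_Icc_self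

lemma toSignedMeasure_posPart_sub_negPart (μ : SignedMeasure ℝ) :
    μ.toJordanDecomposition.posPart.toSignedMeasure -
      μ.toJordanDecomposition.negPart.toSignedMeasure = μ :=
  μ.toSignedMeasure_toJordanDecomposition

lemma signedMeasure_apply_eq (μ : SignedMeasure ℝ) {s : Set ℝ} (hs : MeasurableSet s) :
    μ s = μ.toJordanDecomposition.posPart.real s - μ.toJordanDecomposition.negPart.real s := by
  conv_lhs => rw [← toSignedMeasure_posPart_sub_negPart μ]
  rw [sub_apply, Measure.toSignedMeasure_apply_measurable hs,
    Measure.toSignedMeasure_apply_measurable hs]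

lemma sintegralOn_Ioc_eq (μ : SignedMeasure ℝ) (P N : Measure ℝ) [IsFiniteMeasure P]
    [IsFiniteMeasure N]
    (h : ∀ s, MeasurableSet s → μ s = P.real s - N.real s) (a b : ℝ) {f : ℝ → ℝ}
    (hf : Continuous f) :
    sintegralOn μ (Ioc a b) f = (∫ t in Ioc a b, f t ∂P) - ∫ t in Ioc a b, f t ∂N := by
  have hmeas : μ.toJordanDecomposition.posPart + N = μ.toJordanDecomposition.negPart + P := by
    ext s hs
    rw [← measureReal_eq_measureReal_iff, measureReal_add_apply, measureReal_add_apply]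
    linarith [h s hs, signedMeasure_apply_eq μ hs]
  have hint := congrArg (fun m : Measure ℝ => ∫ t in Ioc a b, f t ∂m) hmeas
  simp only [Measure.restrict_add] at hint
  rw [integral_add_measure (integrable_restrict_Ioc hf a b _) (integrable_restrict_Ioc hf a b _),
    integral_add_measure (integrable_restrict_Ioc hf a b _)
      (integrable_restrict_Ioc hf a b _)] at hint
  unfold sintegralOn
  linarith

lemma ConcentratedOn.sintegral_eq {μ : SignedMeasure ℝ} {s : Set ℝ}
    (h : ConcentratedOn μ s) (f : ℝ → ℝ) : sintegral μ f = sintegralOn μ s f := by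
  rw [ConcentratedOn, SignedMeasure.totalVariation, Measure.add_apply, add_eq_zero] at h
  rw [sintegral, sintegralOn, Measure.restrict_eq_self_of_ae_mem (mem_ae_iff.2 h.1),
    Measure.restrict_eq_self_of_ae_mem (mem_ae_iff.2 h.2)]

/-- **Remark 2.8, formula (2.8c).** If the total masses and moments up to order `n`
of `μ₁` and `μ₂` agree, then
`H_n(x) = (−1)^{n+1} ∫_{(a,b]} (t − x)₊ⁿ / n! d(μ₂ − μ₁)(t)` for all `x ∈ [a,b]`,
where `H₀ = F₂ − F₁` and `H_k(x) = ∫_a^x H_{k−1}(t) dt`. -/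
theorem statement8 (a b : ℝ) (hab : a < b) (n : ℕ) (hn : 1 ≤ n)
    (μ₁ μ₂ : SignedMeasure ℝ)
    (hμ₁ : ConcentratedOn μ₁ (Ioc a b)) (hμ₂ : ConcentratedOn μ₂ (Ioc a b))
    (F₁ F₂ : ℝ → ℝ)
    (hF₁ : ∀ x, F₁ x = μ₁ (Ioc a x)) (hF₂ : ∀ x, F₂ x = μ₂ (Ioc a x))
    (hmass : μ₁ (Ioc a b) = μ₂ (Ioc a b))
    (hmom : ∀ k, 1 ≤ k → k ≤ n →
      sintegral μ₁ (fun t => t ^ k) = sintegral μ₂ (fun t => t ^ k)) :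
    ∀ x ∈ Icc a b,
      iterInt a (fun t => F₂ t - F₁ t) n x =
        (-1 : ℝ) ^ (n + 1) *
          sintegralOn (μ₂ - μ₁) (Ioc a b)
            (fun t => (max (t - x) 0) ^ n / (n.factorial : ℝ)) := by
  intro x hx
  set P₁ := μ₁.toJordanDecomposition.posPart
  set N₁ := μ₁.toJordanDecomposition.negPart
  set P₂ := μ₂.toJordanDecomposition.posPart
  set N₂ := μ₂.toJordanDecomposition.negPart
  have hdiff : ∀ s, MeasurableSet s → (μ₂ - μ₁) s = (P₂ + N₁).real s - (N₂ + P₁).real s := by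
    intro s hs
    rw [sub_apply, measureReal_add_apply, measureReal_add_apply,
      signedMeasure_apply_eq μ₁ hs, signedMeasure_apply_eq μ₂ hs]
    ring
  have hF : ∀ y, F₂ y - F₁ y = (P₂ + N₁).real (Ioc a y) - (N₂ + P₁).real (Ioc a y) := by
    intro y
    rw [hF₁, hF₂, ← hdiff _ measurableSet_Ioc, sub_apply]
  have hmoments : ∀ k ≤ n, ∫ t in Ioc a b, t ^ k ∂(P₂ + N₁) = ∫ t in Ioc a b, t ^ k ∂(N₂ + P₁) := by
    intro k hk
    rcases Nat.eq_zero_or_pos k with rfl | hk0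
    · have h := hdiff (Ioc a b) measurableSet_Ioc
      rw [sub_apply, hmass, sub_self] at h
      simp only [pow_zero, setIntegral_const, smul_eq_mul, mul_one]
      linarith
    · have h := hmom k hk0 hk
      rw [hμ₁.sintegral_eq, hμ₂.sintegral_eq, sintegralOn, sintegralOn] at h
      have hint := fun m : Measure ℝ => fun _ : IsFiniteMeasure m =>
        integrable_restrict_Ioc (continuous_pow k) a b m
      rw [Measure.restrict_add, Measure.restrict_add,
        integral_add_measure (hint _ inferInstance) (hint _ inferInstance),
        integral_add_measure (hint _ inferInstance) (hint _ inferInstance)]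
      linarith
  have hpow := integral_sub_pow_eq
    (fun k => integrable_restrict_Ioc (continuous_pow k) a b (P₂ + N₁))
    (fun k => integrable_restrict_Ioc (continuous_pow k) a b (N₂ + P₁)) hmoments x
  have hcont : Continuous fun t : ℝ => (max (t - x) 0) ^ n / (n.factorial : ℝ) := by fun_prop
  have hcont' : Continuous fun t : ℝ => (x - t) ^ n / (n.factorial : ℝ) := by fun_prop
  rw [iterInt_eq_integral_truncKernel (P₂ + N₁) (N₂ + P₁) _ hF n x hx,
    sintegralOn_Ioc_eq _ _ _ hdiff a b hcont]
  simp only [truncKernel_eq (Nat.one_le_iff_ne_zero.1 hn)]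
  rw [integral_add (integrable_restrict_Ioc hcont' a b _)
      ((integrable_restrict_Ioc hcont a b _).const_mul _),
    integral_add (integrable_restrict_Ioc hcont' a b _)
      ((integrable_restrict_Ioc hcont a b _).const_mul _),
    integral_const_mul, integral_const_mul]
  simp only [integral_div, hpow]
  ring
end
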